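/- Let p be a prime in the set {59, 83, 107, 179, 227, 347, 419, 443, 467, 563, 587, 659, 683, 827, 947}. Then there exist no coprime positive integers x, y and integer m > 0 such that x² + 3^(2m) = 2·y^p. -/

import Mathlib

/-- `δ₄ = 1` if `p ≡ 1 (mod 4)` and `δ₄ = -1` if `p ≡ 3 (mod 4)`. -/
def d4 (p : ℕ) : ℤ := if p % 4 = 1 then 1 else -1

/-- `δ₈ = 1` if `p ≡ 1, 3 (mod 8)` and `δ₈ = -1` if `p ≡ 5, 7 (mod 8)`. -/
def d8 (p : ℕ) : ℤ := if p % 8 = 1 ∨ p % 8 = 3 then 1 else -1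

/-- `F_p(u,v) = Re((1+i)(u+iv)^p)`. -/
def Ffun (p : ℕ) (u v : ℤ) : ℤ :=
  ((⟨1, 1⟩ : GaussianInt) * (⟨u, v⟩ : GaussianInt) ^ p).re

/-- `G_p(u,v) = Im((1+i)(u+iv)^p)`. -/
def Gfun (p : ℕ) (u v : ℤ) : ℤ :=
  ((⟨1, 1⟩ : GaussianInt) * (⟨u, v⟩ : GaussianInt) ^ p).im

/-- `H_p(u,v) = G_p(u,v)/(u + δ₄ v)` (exact division whenever `u + δ₄ v ≠ 0`). -/
def Hfun (p : ℕ) (u v : ℤ) : ℤ := Gfun p u v / (u + d4 p * v)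

/-- Powers of a Gaussian integer modulo its imaginary part. -/
lemma gi_pow_mod_im (w d : ℤ) (N : ℕ) : ∃ A B : ℤ,
    ((⟨w, d⟩ : GaussianInt) ^ N).re = w ^ N + d * A ∧
    ((⟨w, d⟩ : GaussianInt) ^ (N)).im * w = d * (N * w ^ N + d * B) := by
  induction N with
  | zero => exact ⟨0, 0, by simp, by simp⟩
  | succ N ih =>
    obtain ⟨A, B, h1, h2⟩ := ih
    refine ⟨w * A - ((⟨w, d⟩ : GaussianInt) ^ N).im, w * B + A * w, ?_, ?_⟩
    · rw [pow_succ, Zsqrtd.re_mul, h1]; ring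
    · rw [pow_succ, Zsqrtd.im_mul, h1]
      push_cast
      linear_combination w * h2

lemma gi_im_dvd (w d : ℤ) (N : ℕ) : d ∣ ((⟨w, d⟩ : GaussianInt) ^ N).im := by
  induction N with
  | zero => simp
  | succ N ih =>
    rw [pow_succ, Zsqrtd.im_mul]
    exact dvd_add (Dvd.intro_left _ rfl) (Dvd.dvd.mul_right ih _)

/-- Powers of a Gaussian integer modulo its real part. -/
lemma gi_pow_mod_re (w d : ℤ) (k : ℕ) :
    w ∣ ((⟨w, d⟩ : GaussianInt) ^ (4 * k + 3)).im + d ^ (4 * k + 3) := by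
  have h := sub_dvd_pow_sub_pow (⟨w, d⟩ : GaussianInt) ((d : GaussianInt) * ⟨0, 1⟩) (4 * k + 3)
  have h1 : (⟨w, d⟩ : GaussianInt) - (d : GaussianInt) * ⟨0, 1⟩ = (w : GaussianInt) := by
    ext <;> simp
  have hI : (⟨0, 1⟩ : GaussianInt) ^ (4 * k + 3) = ⟨0, -1⟩ := by
    have h4 : (⟨0, 1⟩ : GaussianInt) ^ 4 = 1 := by decide
    rw [pow_add, pow_mul, h4, one_pow, one_mul]; decide
  rw [h1, mul_pow, hI, Zsqrtd.intCast_dvd] at h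
  have h2 := h.2
  have e : ((d : GaussianInt) ^ (4 * k + 3) * (⟨0, -1⟩ : GaussianInt)).im = - d ^ (4 * k + 3) := by
    rw [← Int.cast_pow]
    generalize d ^ (4 * k + 3) = c
    simp
  rw [Zsqrtd.im_sub, e] at h2
  simpa using h2

lemma gi_unit_pow (u : GaussianIntˣ) (k : ℕ) : ∃ v : GaussianInt, (u : GaussianInt) = v ^ (4 * k + 3) := by
  have hu : (u : GaussianInt) ^ 4 = 1 := by
    have h1 : ((u : GaussianInt)).norm.natAbs = 1 := Zsqrtd.norm_eq_one_iff.2 u.isUnit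
    have h2 : ((u : GaussianInt)).norm = 1 := by
      have := GaussianInt.abs_natCast_norm (u : GaussianInt); omega
    rw [Zsqrtd.norm_def] at h2
    set z := (u : GaussianInt)
    have ha : z.re ^ 2 ≤ 1 := by nlinarith [sq_nonneg z.im]
    have hb : z.im ^ 2 ≤ 1 := by nlinarith [sq_nonneg z.re]
    have ha1 : -1 ≤ z.re ∧ z.re ≤ 1 := abs_le.1 ((sq_le_one_iff_abs_le_one _).1 ha)
    have hb1 : -1 ≤ z.im ∧ z.im ≤ 1 := abs_le.1 ((sq_le_one_iff_abs_le_one _).1 hb)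
    have hz : z = ⟨z.re, z.im⟩ := rfl
    rw [hz]
    generalize z.re = a at *
    generalize z.im = b at *
    obtain ⟨a1, a2⟩ := ha1
    obtain ⟨b1, b2⟩ := hb1
    interval_cases a <;> interval_cases b <;> first | decide | omega
  refine ⟨(u : GaussianInt) ^ 3, ?_⟩
  rw [← pow_mul, show 3 * (4 * k + 3) = 4 * (3 * k + 2) + 1 by ring, pow_add, pow_mul, hu]
  simp

/-- The factorisation in the Gaussian integers. -/
lemma gi_factor (p k : ℕ) (hpk : p = 8 * k + 3) (x D y : ℤ) (hx : Odd x) (hD : Odd D)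
    (hy : Odd y) (hxy : IsCoprime x y) (h : x ^ 2 + D ^ 2 = 2 * y ^ p) (hy0 : 0 < y) :
    ∃ w d : ℤ, w ^ 2 + d ^ 2 = 2 * y ∧
      ((⟨w, d⟩ : GaussianInt) ^ p).im = 2 ^ (4 * k + 1) * D := by
  obtain ⟨s, hs⟩ : ∃ s, x + D = 2 * s := (hx.add_odd hD).two_dvd
  obtain ⟨t, ht⟩ : ∃ t, D - x = 2 * t := (hD.sub_odd hx).two_dvd
  have hDst : D = s + t := by linarith
  have hxst : x = s - t := by linarith
  have hst : s ^ 2 + t ^ 2 = y ^ p := by rw [hDst, hxst] at h; linarith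
  have hz : (⟨s, t⟩ : GaussianInt) * ⟨s, -t⟩ = (y : GaussianInt) ^ p := by
    rw [← Int.cast_pow, ← hst]
    have : ((s ^ 2 + t ^ 2 : ℤ) : GaussianInt) = ⟨s ^ 2 + t ^ 2, 0⟩ := rfl
    rw [this]
    ext
    · simp; ring
    · simp; ring
  have hcop : IsCoprime (⟨s, t⟩ : GaussianInt) ⟨s, -t⟩ := by
    have h2 : IsCoprime (2 * x) (y ^ p) := by
      apply IsCoprime.pow_right
      apply IsCoprime.mul_left _ hxy
      obtain ⟨j, hj⟩ := hy
      exact ⟨-j, 1, by rw [hj]; ring⟩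
    obtain ⟨a, b, hab⟩ := h2
    refine ⟨a * ⟨1, 1⟩ + b * ⟨s, -t⟩, a * ⟨1, -1⟩, ?_⟩
    have e : (a : GaussianInt) * (2 * x : ℤ) + b * ((y : GaussianInt) ^ p) = 1 := by
      exact_mod_cast congrArg (Int.cast : ℤ → GaussianInt) hab
    rw [← hz] at e
    rw [← e, hxst]
    have : ((2 * (s - t) : ℤ) : GaussianInt) = ⟨1, 1⟩ * ⟨s, t⟩ + ⟨1, -1⟩ * ⟨s, -t⟩ := by
      ext <;> simp <;> ring
    rw [this]; ring
  obtain ⟨a, u, hau⟩ := exists_associated_pow_of_mul_eq_pow' hcop hz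
  have hp4 : p = 4 * (2 * k) + 3 := by omega
  obtain ⟨v, hv⟩ := gi_unit_pow u (2 * k)
  rw [← hp4] at hv
  rw [hv, ← mul_pow] at hau
  set b := a * v with hb
  have hst' : (star b) ^ p = ⟨s, -t⟩ := by
    rw [← star_pow, hau]; ext <;> simp
  have hnorm : b.norm ^ p = y ^ p := by
    have h1 : b * star b = (b.norm : GaussianInt) := (Zsqrtd.norm_eq_mul_conj b).symm
    have h2 : (b.norm : GaussianInt) ^ p = (y : GaussianInt) ^ p := by
      rw [← h1, mul_pow, hau, hst', hz]
    exact_mod_cast h2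
  have hby : b.norm = y := by
    have hodd : Odd p := by rw [hp4]; exact ⟨4 * k + 1, by ring⟩
    exact (Odd.strictMono_pow hodd).injective hnorm
  refine ⟨b.re + b.im, b.re - b.im, ?_, ?_⟩
  · rw [← hby, Zsqrtd.norm_def]; ring
  · have e1 : (⟨b.re + b.im, b.re - b.im⟩ : GaussianInt) = ⟨1, 1⟩ * star b := by
      ext <;> simp <;> ring
    have e2 : (⟨1, 1⟩ : GaussianInt) ^ p = ((2 ^ (4 * k + 1) : ℤ) : GaussianInt) * ⟨-1, 1⟩ := by
      have h8 : (⟨1, 1⟩ : GaussianInt) ^ 8 = ((2 ^ 4 : ℤ) : GaussianInt) := by decide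
      rw [hpk, pow_add, pow_mul, h8, pow_add, pow_mul, Int.cast_mul, Int.cast_pow, mul_assoc]
      congr 1
      push_cast
      rfl
    rw [e1, mul_pow, e2, hst', mul_assoc, Zsqrtd.im_mul, hDst]
    generalize (2 : ℤ) ^ (4 * k + 1) = c
    simp
    left
    ring

/-- Reduction of the equation to a statement about a Lehmer number. -/
lemma reduction (p k : ℕ) (hpk : p = 24 * k + 11) (x y m : ℕ) (hx : 0 < x) (hy : 0 < y)
    (hm : 0 < m) (hxy : Nat.gcd x y = 1) (h : x ^ 2 + 3 ^ (2 * m) = 2 * y ^ p) :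
    ∃ w : ℤ, 0 ≤ w ∧ ¬ (3 : ℤ) ∣ w ∧ w ^ 2 + (3 ^ m) ^ 2 = 2 * (y : ℤ) ∧
      (((⟨w, 3 ^ m⟩ : GaussianInt) ^ p).im = 2 ^ (12 * k + 5) * 3 ^ m ∨
       ((⟨w, 3 ^ m⟩ : GaussianInt) ^ p).im = - (2 ^ (12 * k + 5) * 3 ^ m)) := by
  have hx3 : ¬ 3 ∣ x := by
    intro h3
    have h1 : 3 ∣ 2 * y ^ p := by
      rw [← h]
      exact dvd_add (dvd_pow h3 two_ne_zero) (dvd_pow_self 3 (by omega))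
    have h2 : 3 ∣ y := by
      rcases (Nat.Prime.dvd_mul Nat.prime_three).1 h1 with h | h
      · omega
      · exact Nat.prime_three.dvd_of_dvd_pow h
    have := Nat.dvd_gcd h3 h2
    omega
  have hZ : (x : ℤ) ^ 2 + (3 ^ m) ^ 2 = 2 * (y : ℤ) ^ p := by
    rw [← pow_mul, mul_comm m 2]; exact_mod_cast h
  have hD : Odd ((3 : ℤ) ^ m) := Odd.pow (by decide)
  have hxo : Odd (x : ℤ) := by
    have h1 : Even ((x : ℤ) ^ 2 + (3 ^ m) ^ 2) := by rw [hZ]; exact even_two_mul _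
    by_contra hne
    rw [Int.not_odd_iff_even] at hne
    have h2 : Odd ((x : ℤ) ^ 2 + (3 ^ m) ^ 2) := (hne.pow_of_ne_zero two_ne_zero).add_odd hD.pow
    exact (Int.not_odd_iff_even.2 h1) h2
  have hyo : Odd (y : ℤ) := by
    by_contra hne
    rw [Int.not_odd_iff_even] at hne
    have h2 : Even ((y : ℤ) ^ p) := hne.pow_of_ne_zero (by omega)
    obtain ⟨a, ha⟩ := hxo
    obtain ⟨b, hb⟩ := hD
    obtain ⟨c, hc⟩ := h2
    rw [ha, hb, hc] at hZ
    ring_nf at hZ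
    omega
  have hcop : IsCoprime (x : ℤ) (y : ℤ) := Nat.isCoprime_iff_coprime.2 hxy
  have hy3 : (y : ℤ) % 3 = 2 := by
    have e1 : ((x : ZMod 3)) ^ 2 = 2 * (y : ZMod 3) ^ p := by
      have := congrArg (Int.cast : ℤ → ZMod 3) hZ
      push_cast at this
      rw [show (3 : ZMod 3) = 0 from rfl, zero_pow hm.ne'] at this
      simpa using this
    have e2 : (y : ZMod 3) ^ p = y := by
      rw [show p = 2 * (12 * k + 5) + 1 by omega, pow_succ, pow_mul]
      generalize (y : ZMod 3) = a
      have h01 : ∀ a : ZMod 3, a = 0 ∨ a ^ 2 = 1 := by decide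
      rcases h01 a with h | h
      · rw [h]; simp
      · rw [h]; simp
    have e3 : (x : ZMod 3) ≠ 0 := by
      rwa [Ne, ZMod.natCast_eq_zero_iff]
    rw [e2] at e1
    clear e2
    have e4 : (y : ZMod 3) = 2 := by
      generalize (y : ZMod 3) = a at *
      generalize (x : ZMod 3) = b at *
      revert a b; decide
    have : (y : ZMod 3) = ((2 : ℕ) : ZMod 3) := e4
    rw [ZMod.natCast_eq_natCast_iff'] at this
    omega
  obtain ⟨w, d, hwd, him⟩ := gi_factor p (3 * k + 1) (by omega) x (3 ^ m) y hxo hD hyo hcop hZ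
    (by exact_mod_cast hy)
  rw [show 4 * (3 * k + 1) + 1 = 12 * k + 5 by ring] at him
  have hdo : Odd d := by
    by_contra hne
    rw [Int.not_odd_iff_even] at hne
    obtain ⟨a, ha⟩ := hyo
    obtain ⟨b, hb⟩ := hne
    rcases Int.even_or_odd w with ⟨c, hc⟩ | ⟨c, hc⟩
    · rw [ha, hb, hc] at hwd; ring_nf at hwd; omega
    · rw [ha, hb, hc] at hwd; ring_nf at hwd; omega
  have hd3 : d ∣ 3 ^ m := by
    have h1 := gi_im_dvd w d p
    rw [him] at h1
    refine IsCoprime.dvd_of_dvd_mul_left ?_ h1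
    apply IsCoprime.pow_right
    obtain ⟨j, hj⟩ := hdo
    exact ⟨1, -j, by rw [hj]; ring⟩
  obtain ⟨j, hjm, hj⟩ := (dvd_prime_pow Int.prime_three m).1 hd3
  have hdj : d = 3 ^ j ∨ d = - 3 ^ j := Int.associated_iff.1 hj
  have hw3d : ∀ c : ℤ, d = 3 * c → ¬ (3 : ℤ) ∣ w := by
    rintro c hc ⟨b, hb⟩
    rw [hc, hb] at hwd
    ring_nf at hwd
    omega
  have hjm' : j = m := by
    by_contra hne
    have hlt : j < m := by omega
    rcases Nat.eq_zero_or_pos j with h0 | h0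
    · have hd1 : d = 1 ∨ d = -1 := by simpa [h0] using hdj
      have hd2 : d ^ 2 = 1 := by rcases hd1 with h | h <;> rw [h] <;> norm_num
      have h3w : (3 : ℤ) ∣ w := by
        apply Int.prime_three.dvd_of_dvd_pow (n := 2)
        omega
      have h1 := gi_pow_mod_re w d (6 * k + 2)
      rw [show 4 * (6 * k + 2) + 3 = p by omega, him] at h1
      have h2 : (3 : ℤ) ∣ d ^ p := by
        rw [← dvd_add_right (a := (3 : ℤ)) (b := 2 ^ (12 * k + 5) * 3 ^ m)]
        · exact h3w.trans h1
        · exact Dvd.dvd.mul_left (dvd_pow_self 3 hm.ne') _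
      have h3 := Int.prime_three.dvd_of_dvd_pow h2
      omega
    · obtain ⟨A, B, -, hB⟩ := gi_pow_mod_im w d p
      rw [him] at hB
      obtain ⟨r, hr⟩ : ∃ r, m = j + (r + 1) := ⟨m - j - 1, by omega⟩
      obtain ⟨i, hi⟩ : ∃ i, j = i + 1 := ⟨j - 1, by omega⟩
      obtain ⟨c, hc, hc3⟩ : ∃ c : ℤ, 3 ^ j = d * c ∧ (c = 1 ∨ c = -1) := by
        rcases hdj with h | h
        · exact ⟨1, by rw [h]; ring, Or.inl rfl⟩
        · exact ⟨-1, by rw [h]; ring, Or.inr rfl⟩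
      have hd0 : d ≠ 0 := by rintro rfl; simp at hdo
      have hd3' : ∃ e, d = 3 * e := by
        rcases hdj with h | h
        · exact ⟨3 ^ i, by rw [h, hi]; ring⟩
        · exact ⟨- 3 ^ i, by rw [h, hi]; ring⟩
      obtain ⟨e, he⟩ := hd3'
      have h1 : 2 ^ (12 * k + 5) * (c * 3 ^ (r + 1)) * w = p * w ^ p + d * B := by
        apply mul_left_cancel₀ hd0
        rw [← hB, hr, pow_add 3 j, hc]; ring
      have h2 : (3 : ℤ) ∣ p * w ^ p := by
        refine ⟨2 ^ (12 * k + 5) * (c * 3 ^ r) * w - e * B, ?_⟩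
        rw [eq_comm, ← sub_eq_zero]
        rw [he, pow_succ] at h1
        linear_combination h1
      rcases Int.prime_three.dvd_or_dvd h2 with h | h
      · omega
      · exact hw3d e he (Int.prime_three.dvd_of_dvd_pow h)
  subst hjm'
  have hw3 : ¬ (3 : ℤ) ∣ w := by
    obtain ⟨i, hi⟩ : ∃ i, j = i + 1 := ⟨j - 1, by omega⟩
    rcases hdj with h | h
    · exact hw3d (3 ^ i) (by rw [h, hi]; ring)
    · exact hw3d (- 3 ^ i) (by rw [h, hi]; ring)
  have hodd : Odd p := ⟨12 * k + 5, by omega⟩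
  -- sign changes
  have hneg : ∀ a b : ℤ, ((⟨-a, -b⟩ : GaussianInt) ^ p).im = - ((⟨a, b⟩ : GaussianInt) ^ p).im := by
    intro a b
    have : (⟨-a, -b⟩ : GaussianInt) = - ⟨a, b⟩ := by ext <;> simp
    rw [this, hodd.neg_pow, Zsqrtd.im_neg]
  have hconj : ∀ a b : ℤ, ((⟨a, -b⟩ : GaussianInt) ^ p).im = - ((⟨a, b⟩ : GaussianInt) ^ p).im := by
    intro a b
    have : (⟨a, -b⟩ : GaussianInt) = star ⟨a, b⟩ := by ext <;> simp
    rw [this, ← star_pow, Zsqrtd.im_star]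
  have hneg2 : ∀ a b : ℤ, ((⟨-a, b⟩ : GaussianInt) ^ p).im = ((⟨a, b⟩ : GaussianInt) ^ p).im := by
    intro a b
    have := hneg a (-b)
    rw [neg_neg, hconj, neg_neg] at this
    exact this
  have hkey : ((⟨w, 3 ^ j⟩ : GaussianInt) ^ p).im = 2 ^ (12 * k + 5) * 3 ^ j ∨
       ((⟨w, 3 ^ j⟩ : GaussianInt) ^ p).im = - (2 ^ (12 * k + 5) * 3 ^ j) := by
    rcases hdj with h | h
    · left; rw [← him, h]
    · right; rw [← him, h, hconj, neg_neg]
  have hsq : d ^ 2 = (3 ^ j) ^ 2 := by rcases hdj with h | h <;> rw [h]; ring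
  rw [hsq] at hwd
  rcases le_total 0 w with hw0 | hw0
  · exact ⟨w, hw0, hw3, hwd, hkey⟩
  · refine ⟨-w, by omega, by rwa [dvd_neg], by rw [neg_sq]; exact hwd, ?_⟩
    rw [hneg2]; exact hkey

/-- Gaussian powers reduce well modulo `ℓ`. -/
lemma gi_mod (l : ℕ) (w d : ℤ) (N : ℕ) :
    ((((⟨w, d⟩ : GaussianInt) ^ N).re : ℤ) : ZMod l) =
      ((⟨(w : ZMod l), (d : ZMod l)⟩ : QuadraticAlgebra (ZMod l) (-1) 0) ^ N).re ∧
    ((((⟨w, d⟩ : GaussianInt) ^ N).im : ℤ) : ZMod l) =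
      ((⟨(w : ZMod l), (d : ZMod l)⟩ : QuadraticAlgebra (ZMod l) (-1) 0) ^ N).im := by
  induction N with
  | zero => simp [QuadraticAlgebra.re_one, QuadraticAlgebra.im_one]
  | succ N ih =>
    rw [pow_succ, pow_succ, Zsqrtd.re_mul, Zsqrtd.im_mul, QuadraticAlgebra.re_mul,
      QuadraticAlgebra.im_mul, ← ih.1, ← ih.2]
    constructor
    · push_cast; ring
    · push_cast; ring

lemma small_one (k : ℕ) (w : ℤ) :
    ((⟨w, 3⟩ : GaussianInt) ^ (24 * k + 11)).im ≠ 2 ^ (12 * k + 5) * 3 ∧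
    ((⟨w, 3⟩ : GaussianInt) ^ (24 * k + 11)).im ≠ -(2 ^ (12 * k + 5) * 3) := by
  have key : ∀ (k : ℕ) (a : ZMod 13),
      (⟨a, 3⟩ : QuadraticAlgebra (ZMod 13) (-1) 0) ^ (24 * k + 11) = (⟨a, 3⟩) ^ 11 := by
    intro k a
    induction k with
    | zero => rfl
    | succ k ih =>
      rw [show 24 * (k + 1) + 11 = (24 * k + 11) + 24 by ring, pow_add, ih, ← pow_add]
      clear ih
      revert a; decide +kernel
  have h2 : (2 : ZMod 13) ^ (12 * k + 5) = 6 := by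
    rw [pow_add, pow_mul, show (2 : ZMod 13) ^ 12 = 1 by decide, one_pow]; decide
  have fin : ∀ a : ZMod 13, ((⟨a, 3⟩ : QuadraticAlgebra (ZMod 13) (-1) 0) ^ 11).im ≠ 6 * 3 ∧
      ((⟨a, 3⟩ : QuadraticAlgebra (ZMod 13) (-1) 0) ^ 11).im ≠ -(6 * 3) := by
    decide +kernel
  have hm := (gi_mod 13 w 3 (24 * k + 11)).2
  have h3 : ((3 : ℤ) : ZMod 13) = 3 := rfl
  rw [h3, key] at hm
  have := fin (w : ZMod 13)
  constructor
  · intro h; rw [h] at hm; push_cast at hm; rw [h2] at hm; exact this.1 hm.symm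
  · intro h; rw [h] at hm; push_cast at hm; rw [h2] at hm; exact this.2 hm.symm

lemma small_two (k : ℕ) (w : ℤ) :
    ((⟨w, 9⟩ : GaussianInt) ^ (24 * k + 11)).im ≠ 2 ^ (12 * k + 5) * 9 ∧
    ((⟨w, 9⟩ : GaussianInt) ^ (24 * k + 11)).im ≠ -(2 ^ (12 * k + 5) * 9) := by
  have key : ∀ (k : ℕ) (a : ZMod 7),
      (⟨a, 9⟩ : QuadraticAlgebra (ZMod 7) (-1) 0) ^ (24 * k + 11) = (⟨a, 9⟩) ^ 11 ∨
      (⟨a, 9⟩ : QuadraticAlgebra (ZMod 7) (-1) 0) ^ (24 * k + 11) = -(⟨a, 9⟩) ^ 11 := by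
    intro k a
    have h : (⟨a, 9⟩ : QuadraticAlgebra (ZMod 7) (-1) 0) ^ 24 = 1 ∨
      (⟨a, 9⟩ : QuadraticAlgebra (ZMod 7) (-1) 0) ^ 24 = -1 := by
      revert a; decide +kernel
    rw [pow_add, pow_mul]
    rcases h with h | h
    · left; rw [h]; simp
    · rw [h]; rcases neg_one_pow_eq_or (QuadraticAlgebra (ZMod 7) (-1) 0) k with h | h
      · left; rw [h]; simp
      · right; rw [h]; simp
  have h2 : (2 : ZMod 7) ^ (12 * k + 5) = 4 := by
    rw [pow_add, pow_mul, show (2 : ZMod 7) ^ 12 = 1 by decide, one_pow]; decide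
  have fin : ∀ a : ZMod 7, ((⟨a, 9⟩ : QuadraticAlgebra (ZMod 7) (-1) 0) ^ 11).im ≠ 4 * 9 ∧
      ((⟨a, 9⟩ : QuadraticAlgebra (ZMod 7) (-1) 0) ^ 11).im ≠ -(4 * 9) := by
    decide +kernel
  have hm := (gi_mod 7 w 9 (24 * k + 11)).2
  have h3 : ((9 : ℤ) : ZMod 7) = 9 := rfl
  rw [h3] at hm
  have := fin (w : ZMod 7)
  have hm' : ((((⟨w, 9⟩ : GaussianInt) ^ (24 * k + 11)).im : ℤ) : ZMod 7) =
      ((⟨(w : ZMod 7), 9⟩ : QuadraticAlgebra (ZMod 7) (-1) 0) ^ 11).im ∨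
      ((((⟨w, 9⟩ : GaussianInt) ^ (24 * k + 11)).im : ℤ) : ZMod 7) =
      -((⟨(w : ZMod 7), 9⟩ : QuadraticAlgebra (ZMod 7) (-1) 0) ^ 11).im := by
    rcases key k (w : ZMod 7) with h | h
    · left; rw [hm, h]
    · right; rw [hm, h, QuadraticAlgebra.im_neg]
  constructor
  · intro h; rw [h] at hm'; push_cast at hm'; rw [h2] at hm'
    rcases hm' with h | h
    · exact this.1 h.symm
    · exact this.2 (by rw [h, neg_neg])
  · intro h; rw [h] at hm'; push_cast at hm'; rw [h2] at hm'
    rcases hm' with h | h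
    · exact this.2 h.symm
    · exact this.1 (neg_injective h).symm

lemma small_three (k : ℕ) (hk : k % 5 = 2 ∨ k % 5 = 3 ∨ k % 5 = 4) (w : ℤ) :
    ((⟨w, 27⟩ : GaussianInt) ^ (24 * k + 11)).im ≠ 2 ^ (12 * k + 5) * 27 ∧
    ((⟨w, 27⟩ : GaussianInt) ^ (24 * k + 11)).im ≠ -(2 ^ (12 * k + 5) * 27) := by
  have key : ∀ (r q : ℕ) (a : ZMod 11),
      (⟨a, 27⟩ : QuadraticAlgebra (ZMod 11) (-1) 0) ^ (24 * (5 * q + r) + 11) =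
        (⟨a, 27⟩) ^ (24 * r + 11) := by
    intro r q a
    have h : (⟨a, 27⟩ : QuadraticAlgebra (ZMod 11) (-1) 0) ^ 120 = 1 := by
      revert a; decide +kernel
    rw [show 24 * (5 * q + r) + 11 = 120 * q + (24 * r + 11) by ring, pow_add, pow_mul, h]
    simp
  have h2 : ∀ r q : ℕ, (2 : ZMod 11) ^ (12 * (5 * q + r) + 5) = 2 ^ (12 * r + 5) := by
    intro r q
    rw [show 12 * (5 * q + r) + 5 = 60 * q + (12 * r + 5) by ring, pow_add, pow_mul,
      show (2 : ZMod 11) ^ 60 = 1 by decide +kernel, one_pow, one_mul]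
  have fin : ∀ r : ℕ, r = 2 ∨ r = 3 ∨ r = 4 → ∀ a : ZMod 11,
      ((⟨a, 27⟩ : QuadraticAlgebra (ZMod 11) (-1) 0) ^ (24 * r + 11)).im ≠ 2 ^ (12 * r + 5) * 27 ∧
      ((⟨a, 27⟩ : QuadraticAlgebra (ZMod 11) (-1) 0) ^ (24 * r + 11)).im ≠
        -(2 ^ (12 * r + 5) * 27) := by
    rintro r (rfl | rfl | rfl) <;> decide +kernel
  have hkq : k = 5 * (k / 5) + k % 5 := by omega
  have hm := (gi_mod 11 w 27 (24 * k + 11)).2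
  have h3 : ((27 : ℤ) : ZMod 11) = 27 := rfl
  have hkk := key (k % 5) (k / 5) (w : ZMod 11)
  have hk2 := h2 (k % 5) (k / 5)
  rw [← hkq] at hkk hk2
  rw [h3, hkk] at hm
  have := fin (k % 5) hk (w : ZMod 11)
  constructor
  · intro h; rw [h] at hm; push_cast at hm; rw [hk2] at hm; exact this.1 hm.symm
  · intro h; rw [h] at hm; push_cast at hm; rw [hk2] at hm; exact this.2 hm.symm

/-- If `w` is large compared to `d`, the imaginary part of `(w + i d)^p` is large. -/
lemma gi_growth (p w d : ℤ) (hd : 0 < d) (hw : p * d ≤ w) (N : ℕ) (hN1 : (N : ℤ) + 1 ≤ p) :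
    0 < ((⟨w, d⟩ : GaussianInt) ^ N).re ∧ 0 ≤ ((⟨w, d⟩ : GaussianInt) ^ N).im ∧
    (p - N) * ((⟨w, d⟩ : GaussianInt) ^ N).im ≤ N * ((⟨w, d⟩ : GaussianInt) ^ N).re := by
  induction N with
  | zero => simp
  | succ N ih =>
    obtain ⟨h1, h2, h3⟩ := ih (by push_cast at hN1; linarith)
    set R := ((⟨w, d⟩ : GaussianInt) ^ N).re
    set I := ((⟨w, d⟩ : GaussianInt) ^ N).im
    have e1 : ((⟨w, d⟩ : GaussianInt) ^ (N + 1)).re = R * w - I * d := by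
      rw [pow_succ, Zsqrtd.re_mul]; ring
    have e2 : ((⟨w, d⟩ : GaussianInt) ^ (N + 1)).im = R * d + I * w := by
      rw [pow_succ, Zsqrtd.im_mul]
    rw [e1, e2]
    push_cast at hN1 ⊢
    have hp : 0 < p := by omega
    have hN : (0 : ℤ) ≤ N := Int.natCast_nonneg N
    have hI1 : I ≤ (p - N) * I := by nlinarith
    have hI2 : I ≤ (p - 1) * R := by nlinarith
    have hw1 : R * (p * d) ≤ R * w := by nlinarith
    have hId : I * d ≤ (p - 1) * R * d := mul_le_mul_of_nonneg_right hI2 hd.le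
    have hRd : 0 < R * d := mul_pos h1 hd
    have hw2 : 0 ≤ w := by nlinarith
    refine ⟨by nlinarith, by nlinarith [mul_nonneg h2 hw2], ?_⟩
    have b1 : R + I ≤ (N + 1) * R - (p - (N + 1)) * I := by linarith
    have b2 : (N + 1) * I + (p - (N + 1)) * R ≤ p * (R + I) := by nlinarith
    have c1 : p * d * (R + I) ≤ w * ((N + 1) * R - (p - (N + 1)) * I) := by
      calc p * d * (R + I) ≤ w * (R + I) := mul_le_mul_of_nonneg_right hw (by linarith)
        _ ≤ _ := mul_le_mul_of_nonneg_left b1 hw2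
    have c2 : d * ((N + 1) * I + (p - (N + 1)) * R) ≤ d * (p * (R + I)) :=
      mul_le_mul_of_nonneg_left b2 hd.le
    linarith

lemma gi_bound (k : ℕ) (w d : ℤ) (hd : 0 < d) (hw : (24 * k + 11 : ℤ) * d ≤ w) :
    2 ^ (12 * k + 5) * d < ((⟨w, d⟩ : GaussianInt) ^ (24 * k + 11)).im := by
  have hw2 : 2 ≤ w := by nlinarith
  have key : ∀ N : ℕ, N + 1 ≤ 24 * k + 11 → w ^ N * d ≤ ((⟨w, d⟩ : GaussianInt) ^ (N + 1)).im := by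
    intro N
    induction N with
    | zero => simp
    | succ N ih =>
      intro hN
      have h1 := ih (by omega)
      have h2 := (gi_growth (24 * k + 11) w d hd hw (N + 1) (by push_cast; omega)).1
      rw [pow_succ _ (N + 1), Zsqrtd.im_mul]
      have h3 := mul_pos h2 hd
      have h4 : w ^ N * d * w ≤ ((⟨w, d⟩ : GaussianInt) ^ (N + 1)).im * w :=
        mul_le_mul_of_nonneg_right h1 (by linarith)
      rw [pow_succ w N]
      simp only at *
      linarith
  refine lt_of_lt_of_le ?_ (key (24 * k + 10) (by omega))
  refine mul_lt_mul_of_pos_right ?_ hd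
  calc (2 : ℤ) ^ (12 * k + 5) < 2 ^ (24 * k + 10) := pow_lt_pow_right₀ (by norm_num) (by omega)
    _ ≤ w ^ (24 * k + 10) := pow_le_pow_left₀ (by norm_num) hw2 _

lemma coprime_three_of_mod (p : ℕ) [hpF : Fact p.Prime] (h3 : p % 3 = 2) : Nat.Coprime 3 p := by
  rw [Nat.Prime.coprime_iff_not_dvd Nat.prime_three]
  omega

/-- The element `3` of the Galois group. -/
noncomputable def thr (p : ℕ) [hpF : Fact p.Prime] (h3 : p % 3 = 2) : (ZMod p)ˣ :=
  ZMod.unitOfCoprime 3 (coprime_three_of_mod p h3)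

lemma thr_coe (p : ℕ) [hpF : Fact p.Prime] (h3 : p % 3 = 2) :
    ((thr p h3 : (ZMod p)ˣ) : ZMod p) = ((3 : ℕ) : ZMod p) := ZMod.coe_unitOfCoprime _ _

section Cyc

open NumberField IsCyclotomicExtension Finset

variable (p : ℕ) [hpF : Fact p.Prime] (L : Type) [Field L] [NumberField L]
  [hcyc : IsCyclotomicExtension {p} ℚ L]

/-- The chosen primitive `p`-th root of unity in the ring of integers. -/
noncomputable def zt : 𝓞 L := (zeta_spec p ℚ L).toInteger

lemma zt_prim : IsPrimitiveRoot (zt p L) p := (zeta_spec p ℚ L).toInteger_isPrimitiveRoot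

/-- Powers of the root of unity indexed by `ZMod p`. -/
noncomputable def zp (a : ZMod p) : 𝓞 L := zt p L ^ a.val

lemma zp_natCast (n : ℕ) : zp p L (n : ZMod p) = zt p L ^ n := by
  unfold zp
  rw [ZMod.val_natCast]
  conv_rhs => rw [← Nat.mod_add_div n p, pow_add, pow_mul, (zt_prim p L).pow_eq_one, one_pow, mul_one]

lemma zp_add (a b : ZMod p) : zp p L (a + b) = zp p L a * zp p L b := by
  have : a + b = ((a.val + b.val : ℕ) : ZMod p) := by simp
  rw [this, zp_natCast, pow_add]; rfl

lemma zp_zero : zp p L 0 = 1 := by simp [zp]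

lemma zp_one : zp p L 1 = zt p L := by
  have := zp_natCast p L 1
  simpa using this

lemma zp_mul_nat (a : ZMod p) (n : ℕ) : zp p L (a * n) = zp p L a ^ n := by
  induction n with
  | zero => simp [zp_zero]
  | succ n ih => rw [Nat.cast_succ, mul_add, mul_one, zp_add, ih, pow_succ]

lemma zp_pow_p (a : ZMod p) : zp p L a ^ p = 1 := by
  rw [← zp_mul_nat]; simp [zp_zero]

lemma zp_eq_one_iff (a : ZMod p) : zp p L a = 1 ↔ a = 0 := by
  unfold zp
  rw [(zt_prim p L).pow_eq_one_iff_dvd]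
  constructor
  · intro h
    have := Nat.eq_zero_of_dvd_of_lt h (ZMod.val_lt a)
    exact (ZMod.val_eq_zero a).1 this
  · rintro rfl; simp

/-- The Galois automorphism attached to `a`. -/
noncomputable def sig : (ZMod p)ˣ ≃* Gal(L/ℚ) := (IsCyclotomicExtension.Rat.galEquivZMod p L).symm

/-- The action of the Galois group on the integers. -/
noncomputable def SS (a : (ZMod p)ˣ) : 𝓞 L ≃+* 𝓞 L :=
  RingOfIntegers.mapRingEquiv (sig p L a : L ≃+* L)

lemma SS_coe (a : (ZMod p)ˣ) (x : 𝓞 L) : ((SS p L a x : 𝓞 L) : L) = sig p L a (x : L) := rfl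

lemma SS_mul (a b : (ZMod p)ˣ) (x : 𝓞 L) : SS p L (a * b) x = SS p L a (SS p L b x) := by
  apply RingOfIntegers.ext
  rw [SS_coe, SS_coe, SS_coe, map_mul]; rfl

lemma SS_one (x : 𝓞 L) : SS p L 1 x = x := by
  apply RingOfIntegers.ext
  rw [SS_coe, map_one]; rfl

lemma SS_zt (a : (ZMod p)ˣ) : SS p L a (zt p L) = zp p L a := by
  apply RingOfIntegers.ext
  rw [SS_coe]
  have h : ((zt p L : 𝓞 L) : L) ^ p = 1 := (zeta_spec p ℚ L).pow_eq_one
  rw [IsCyclotomicExtension.Rat.galEquivZMod_apply_of_pow_eq p L (sig p L a) h]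
  simp only [sig, MulEquiv.apply_symm_apply]
  rfl

lemma SS_zp (a : (ZMod p)ˣ) (b : ZMod p) : SS p L a (zp p L b) = zp p L (a * b) := by
  have : (a : ZMod p) * b = a * ((b.val : ℕ) : ZMod p) := by simp
  rw [this, zp_mul_nat, ← SS_zt, ← map_pow]; rfl

/-- Induction principle for the ring of integers. -/
lemma O_induct (P : 𝓞 L → Prop) (hInt : ∀ n : ℤ, P n) (hz : P (zt p L))
    (hadd : ∀ x y, P x → P y → P (x + y)) (hmul : ∀ x y, P x → P y → P (x * y)) (x : 𝓞 L) :
    P x := by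
  have htop := (zeta_spec p ℚ L).integralPowerBasis.adjoin_gen_eq_top
  rw [IsPrimitiveRoot.integralPowerBasis_gen] at htop
  have hx : x ∈ Algebra.adjoin ℤ {(zeta_spec p ℚ L).toInteger} := by rw [htop]; trivial
  induction hx using Algebra.adjoin_induction with
  | mem x hx => rw [Set.mem_singleton_iff.1 hx]; exact hz
  | algebraMap r => exact hInt r
  | add x y _ _ hx hy => exact hadd x y hx hy
  | mul x y _ _ hx hy => exact hmul x y hx hy

/-- Additive functionals on the ring of integers. -/
lemma exists_functional (h : ZMod p → ZMod 3) (hsum : ∑ a, h a = 0) :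
    ∃ Λ : 𝓞 L →+ ZMod 3, ∀ a, Λ (zp p L a) = h a := by
  set B := (zeta_spec p ℚ L).integralPowerBasis with hB
  have hdim : B.dim = p - 1 := by
    rw [hB, IsPrimitiveRoot.integralPowerBasis_dim, Nat.totient_prime hpF.out]
  have hp1 := hpF.out.one_lt
  set Λ := (B.basis.constr ℤ (fun i => h ((i : ℕ) : ZMod p))) with hΛ
  have h1 : ∀ i : ℕ, i < p - 1 → Λ (zt p L ^ i) = h (i : ZMod p) := by
    intro i hi
    have := B.basis.constr_basis ℤ (fun i => h ((i : ℕ) : ZMod p)) ⟨i, by omega⟩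
    rw [B.basis_eq_pow] at this
    have hgen : B.gen = zt p L := by rw [hB, IsPrimitiveRoot.integralPowerBasis_gen]; rfl
    rw [hgen] at this
    exact this
  have h2 : Λ (zt p L ^ (p - 1)) = h ((p - 1 : ℕ) : ZMod p) := by
    have hg : ∑ i ∈ range p, zt p L ^ i = 0 := (zt_prim p L).geom_sum_eq_zero hp1
    have hs : ∑ i ∈ range p, h (i : ZMod p) = 0 := by
      rw [← hsum]
      obtain ⟨q, rfl⟩ : ∃ q, p = q + 1 := ⟨p - 1, by omega⟩
      rw [Finset.sum_range]
      apply Finset.sum_congr rfl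
      intro i _
      congr 1
      exact Fin.cast_val_eq_self i
    obtain ⟨q, hq⟩ : ∃ q, p = q + 1 := ⟨p - 1, by omega⟩
    have hr : range p = range (q + 1) := by rw [← hq]
    rw [hr, sum_range_succ] at hg hs
    have hq' : p - 1 = q := by omega
    rw [hq']
    have := congrArg Λ hg
    rw [map_add, map_sum, map_zero, sum_congr rfl
      (fun i hi => h1 i (by rw [mem_range] at hi; omega))] at this
    rw [← hs] at this
    exact add_left_cancel this
  refine ⟨Λ.toAddMonoidHom, ?_⟩
  intro a
  have ha : a.val < p := ZMod.val_lt a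
  have e : a = ((a.val : ℕ) : ZMod p) := by simp
  show Λ (zt p L ^ a.val) = h a
  by_cases hlt : a.val < p - 1
  · rw [h1 _ hlt, ← e]
  · have : a.val = p - 1 := by omega
    rw [this, h2, ← this, ← e]

variable (h3 : p % 3 = 2)

lemma SS_thr_zp (a : ZMod p) : SS p L (thr p h3) (zp p L a) = zp p L a ^ 3 := by
  rw [SS_zp, thr_coe, mul_comm, zp_mul_nat]

lemma frob (x : 𝓞 L) : (3 : 𝓞 L) ∣ x ^ 3 - SS p L (thr p h3) x := by
  induction x using O_induct p L with
  | hInt n =>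
    rw [map_intCast]
    have : (3 : ℤ) ∣ n ^ 3 - n := by
      have h : ∀ a : ZMod 3, a ^ 3 - a = 0 := by decide
      have h' := h (n : ZMod 3)
      have : ((n ^ 3 - n : ℤ) : ZMod 3) = 0 := by push_cast; exact h'
      exact_mod_cast (ZMod.intCast_zmod_eq_zero_iff_dvd _ 3).1 this
    have := map_dvd (Int.castRingHom (𝓞 L)) this
    simpa using this
  | hz =>
    rw [← zp_one, SS_thr_zp, sub_self]; exact dvd_zero _
  | hadd x y hx hy =>
    rw [map_add]
    obtain ⟨a, ha⟩ := hx
    obtain ⟨b, hb⟩ := hy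
    exact ⟨a + b + x ^ 2 * y + x * y ^ 2, by linear_combination ha + hb⟩
  | hmul x y hx hy =>
    rw [map_mul]
    obtain ⟨a, ha⟩ := hx
    obtain ⟨b, hb⟩ := hy
    exact ⟨a * y ^ 3 + SS p L (thr p h3) x * b, by linear_combination y ^ 3 * ha + SS p L (thr p h3) x * hb⟩

include h3 in
lemma three_dvd_of_cube (x : 𝓞 L) (hx : (3 : 𝓞 L) ∣ x ^ 3) : (3 : 𝓞 L) ∣ x := by
  have h := (dvd_sub_right hx).1 (frob p L h3 x)
  have h' := map_dvd (SS p L (thr p h3)).symm h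
  rw [RingEquiv.symm_apply_apply] at h'
  have e : (SS p L (thr p h3)).symm (3 : 𝓞 L) = 3 := map_ofNat _ 3
  rwa [e] at h'

include h3 in
lemma three_dvd_of_cube_sub (x : 𝓞 L) (hx : (3 : 𝓞 L) ∣ x ^ 3 - 1) : (3 : 𝓞 L) ∣ x - 1 := by
  have h : (3 : 𝓞 L) ∣ SS p L (thr p h3) (x - 1) := by
    have := dvd_sub hx (frob p L h3 x)
    rw [map_sub, map_one]
    convert this using 1; ring
  have h' := map_dvd (SS p L (thr p h3)).symm h
  rw [RingEquiv.symm_apply_apply] at h'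
  have e : (SS p L (thr p h3)).symm (3 : 𝓞 L) = 3 := map_ofNat _ 3
  rwa [e] at h'

/-- The elements `f_a`. -/
noncomputable def ff (a : ZMod p) : 𝓞 L := ∑ i ∈ range ((p + 1) / 3), zp p L (a * ((3 * i + 1 : ℕ) : ZMod p))

lemma SS_ff (a : (ZMod p)ˣ) (b : ZMod p) : SS p L a (ff p L b) = ff p L (a * b) := by
  unfold ff
  rw [map_sum]
  exact sum_congr rfl fun i _ => by rw [SS_zp, mul_assoc]

include h3 in
lemma ff_mul (a : ZMod p) : ff p L a * (zp p L a ^ 3 - 1) = zp p L a * (zp p L a - 1) := by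
  have e : ff p L a = zp p L a * ∑ i ∈ range ((p + 1) / 3), (zp p L a ^ 3) ^ i := by
    unfold ff
    rw [mul_sum]
    exact sum_congr rfl fun i _ => by rw [zp_mul_nat, pow_succ, pow_mul]; ring
  rw [e, mul_assoc, geom_sum_mul, ← pow_mul, show 3 * ((p + 1) / 3) = p + 1 by omega, pow_succ,
    zp_pow_p, one_mul]

include h3 in
lemma ff_cube (a : ZMod p) : (1 - zp p L a) ^ 3 = (1 - zp p L a ^ 3) * (1 - 3 * ff p L a) := by
  linear_combination (-3) * ff_mul p L h3 a

end Cyc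

/-- An abstract criterion for being a cube. -/
lemma abs_cube {E V : Type*} [CommGroup E] [AddCommGroup V] [Module (ZMod 3) V] (r : ℕ)
    (fs : Fin r → E) (hgen : ∀ x, ∃ t : E, ∃ e : Fin r → ℤ, x = t ^ 3 * ∏ i, fs i ^ e i)
    (φ : E →* Multiplicative V) {ι : Type*} [Fintype ι] (hr : r ≤ Fintype.card ι) (v : ι → E)
    (hv : LinearIndependent (ZMod 3) (fun i => Multiplicative.toAdd (φ (v i))))
    (x : E) (hx : φ x = 1) : ∃ y, x = y ^ 3 := by
  classical
  have h3V : ∀ a : V, (3 : ℕ) • a = 0 := by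
    intro a
    rw [← Nat.cast_smul_eq_nsmul (ZMod 3)]
    have : ((3 : ℕ) : ZMod 3) = 0 := rfl
    rw [this, zero_smul]
  let g : Fin r → V := fun i => Multiplicative.toAdd (φ (fs i))
  let T : (Fin r → ZMod 3) →ₗ[ZMod 3] V := Fintype.linearCombination (ZMod 3) g
  have hφ : ∀ (t : E) (e : Fin r → ℤ), Multiplicative.toAdd (φ (t ^ 3 * ∏ i, fs i ^ e i)) =
      T (fun i => (e i : ZMod 3)) := by
    intro t e
    rw [map_mul, map_pow, map_prod, toAdd_mul, toAdd_pow, h3V, zero_add, toAdd_prod,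
      Fintype.linearCombination_apply]
    refine Finset.sum_congr rfl fun i _ => ?_
    rw [map_zpow, toAdd_zpow, Int.cast_smul_eq_zsmul]
  have hrange : ∀ y : E, Multiplicative.toAdd (φ y) ∈ LinearMap.range T := by
    intro y
    obtain ⟨t, e, he⟩ := hgen y
    rw [he, hφ]
    exact ⟨_, rfl⟩
  have hfin : Fintype.card ι ≤ Module.finrank (ZMod 3) (LinearMap.range T) := by
    have hli : LinearIndependent (ZMod 3)
        (fun i => (⟨Multiplicative.toAdd (φ (v i)), hrange (v i)⟩ : LinearMap.range T)) := by
      apply LinearIndependent.of_comp (LinearMap.range T).subtype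
      exact hv
    exact hli.fintype_card_le_finrank
  have hker : Module.finrank (ZMod 3) (LinearMap.ker T) = 0 := by
    have := LinearMap.finrank_range_add_finrank_ker T
    rw [Module.finrank_fin_fun] at this
    omega
  have hinj : LinearMap.ker T = ⊥ := Submodule.finrank_eq_zero.1 hker
  obtain ⟨t, e, he⟩ := hgen x
  have h0 : T (fun i => (e i : ZMod 3)) = 0 := by
    rw [← hφ t e, ← he, hx]; rfl
  have h1 : (fun i => (e i : ZMod 3)) = 0 := by
    have : (fun i => (e i : ZMod 3)) ∈ LinearMap.ker T := h0
    rw [hinj] at this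
    exact this
  have h2 : ∀ i, ∃ c : ℤ, e i = 3 * c := by
    intro i
    have := congrFun h1 i
    exact (ZMod.intCast_zmod_eq_zero_iff_dvd (e i) 3).1 this
  choose c hc using h2
  refine ⟨t * ∏ i, fs i ^ c i, ?_⟩
  rw [he, mul_pow, ← Finset.prod_pow]
  congr 1
  refine Finset.prod_congr rfl fun i _ => ?_
  rw [hc i, mul_comm, zpow_mul]
  norm_cast

section Cyc2

open NumberField IsCyclotomicExtension Finset

variable (p : ℕ) [hpF : Fact p.Prime] (L : Type) [Field L] [NumberField L]
  [hcyc : IsCyclotomicExtension {p} ℚ L] (h3 : p % 3 = 2)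

lemma exists_tt (u : (𝓞 L)ˣ) : ∃ t : 𝓞 L, (u : 𝓞 L) ^ 3 = SS p L (thr p h3) u * (1 + 3 * t) := by
  obtain ⟨c, hc⟩ := frob p L h3 (u : 𝓞 L)
  have hu : SS p L (thr p h3) (u : 𝓞 L) * SS p L (thr p h3) ((u⁻¹ : (𝓞 L)ˣ) : 𝓞 L) = 1 := by
    rw [← map_mul]; simp
  refine ⟨SS p L (thr p h3) ((u⁻¹ : (𝓞 L)ˣ) : 𝓞 L) * c, ?_⟩
  linear_combination hc - 3 * c * hu

/-- The logarithm of a unit. -/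
noncomputable def tt (u : (𝓞 L)ˣ) : 𝓞 L := (exists_tt p L h3 u).choose

lemma tt_spec (u : (𝓞 L)ˣ) :
    (u : 𝓞 L) ^ 3 = SS p L (thr p h3) u * (1 + 3 * tt p L h3 u) := (exists_tt p L h3 u).choose_spec

lemma SS_unit_ne (a : (ZMod p)ˣ) (u : (𝓞 L)ˣ) : SS p L a (u : 𝓞 L) ≠ 0 := by
  intro h
  have : (u : 𝓞 L) = 0 := (map_eq_zero_iff _ (SS p L a).injective).1 h
  exact u.ne_zero this

lemma tt_mul (u v : (𝓞 L)ˣ) : tt p L h3 (u * v) =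
    tt p L h3 u + tt p L h3 v + 3 * (tt p L h3 u * tt p L h3 v) := by
  have h1 := tt_spec p L h3 u
  have h2 := tt_spec p L h3 v
  have h := tt_spec p L h3 (u * v)
  rw [Units.val_mul, mul_pow, map_mul, h1, h2] at h
  have hu := SS_unit_ne p L (thr p h3) u
  have hv := SS_unit_ne p L (thr p h3) v
  have h3' : (3 : 𝓞 L) ≠ 0 := by norm_num
  apply mul_left_cancel₀ (mul_ne_zero (mul_ne_zero hu hv) h3')
  linear_combination -h

lemma Lam_three (Λ : 𝓞 L →+ ZMod 3) (x : 𝓞 L) : Λ (3 * x) = 0 := by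
  have : (3 : 𝓞 L) * x = (3 : ℕ) • x := by simp
  rw [this, map_nsmul]
  generalize Λ x = a
  revert a; decide

/-- The logarithm as a homomorphism. -/
noncomputable def Psi (Λ : 𝓞 L →+ ZMod 3) : (𝓞 L)ˣ →* Multiplicative ((ZMod p)ˣ → ZMod 3) :=
  MonoidHom.mk' (fun u => Multiplicative.ofAdd (fun s => Λ (SS p L s (tt p L h3 u)))) (by
    intro u v
    rw [← ofAdd_add]
    congr 1
    funext s
    rw [tt_mul, map_add, map_add, map_mul, map_ofNat, map_add, map_add, Lam_three, add_zero]
    rfl)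

lemma Psi_apply (Λ : 𝓞 L →+ ZMod 3) (u : (𝓞 L)ˣ) (s : (ZMod p)ˣ) :
    Multiplicative.toAdd (Psi p L h3 Λ u) s = Λ (SS p L s (tt p L h3 u)) := rfl

lemma zp_ne_one (a : (ZMod p)ˣ) : zp p L a ≠ 1 := by
  rw [Ne, zp_eq_one_iff]; exact a.ne_zero

lemma zp_cube_ne_one (h3 : p % 3 = 2) (a : (ZMod p)ˣ) : zp p L a ^ 3 ≠ 1 := by
  rw [← SS_thr_zp p L h3, SS_zp]
  exact_mod_cast zp_ne_one p L (thr p h3 * a)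

lemma Psi_frac (Λ : 𝓞 L →+ ZMod 3) (u : (𝓞 L)ˣ) (a b : (ZMod p)ˣ)
    (h : (u : 𝓞 L) * (1 - zp p L b) = 1 - zp p L a) (s : (ZMod p)ˣ) :
    Multiplicative.toAdd (Psi p L h3 Λ u) s =
      Λ (ff p L ((s * b : (ZMod p)ˣ) : ZMod p)) - Λ (ff p L ((s * a : (ZMod p)ˣ) : ZMod p)) := by
  have ht := tt_spec p L h3 u
  set t := tt p L h3 u with htdef
  have hS : SS p L (thr p h3) (u : 𝓞 L) * (1 - zp p L b ^ 3) = 1 - zp p L a ^ 3 := by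
    rw [← SS_thr_zp p L h3, ← SS_thr_zp p L h3, ← map_one (SS p L (thr p h3)), ← map_sub, ← map_sub,
      ← map_mul, h]
  have ha := ff_cube p L h3 a
  have hb := ff_cube p L h3 b
  have hne : (1 - zp p L b ^ 3) ≠ 0 := sub_ne_zero.2 (zp_cube_ne_one p L h3 b).symm
  have hu := SS_unit_ne p L (thr p h3) u
  have h3' : (3 : 𝓞 L) ≠ 0 := by norm_num
  have key : t = ff p L b - ff p L a + 3 * (t * ff p L b) := by
    have hc : ((u : 𝓞 L) * (1 - zp p L b)) ^ 3 = (1 - zp p L a) ^ 3 := by rw [h]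
    rw [mul_pow, ha, hb, ht, ← hS] at hc
    apply mul_left_cancel₀ (mul_ne_zero (mul_ne_zero hu hne) h3')
    linear_combination hc
  rw [Psi_apply, ← htdef, key, map_add, map_sub, map_mul, map_ofNat, SS_ff, SS_ff, map_add, map_sub,
    Lam_three, add_zero]
  simp only [Units.val_mul]

lemma Psi_nine (Λ : 𝓞 L →+ ZMod 3) (u : (𝓞 L)ˣ) (h : (9 : 𝓞 L) ∣ (u : 𝓞 L) - 1) :
    Psi p L h3 Λ u = 1 := by
  obtain ⟨c, hc⟩ := h
  have hu1 : (u : 𝓞 L) = 1 + 9 * c := by linear_combination hc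
  have ht := tt_spec p L h3 u
  set t := tt p L h3 u with htdef
  have h3' : (3 : 𝓞 L) ≠ 0 := by norm_num
  have h9 : SS p L (thr p h3) (9 : 𝓞 L) = 9 := map_ofNat _ 9
  have key : t = 3 * (3 * c + 27 * c ^ 2 + 81 * c ^ 3 - SS p L (thr p h3) c * (1 + 3 * t)) := by
    apply mul_left_cancel₀ h3'
    rw [hu1, map_add, map_mul, h9, map_one] at ht
    linear_combination -ht
  apply Multiplicative.toAdd.injective
  funext s
  rw [Psi_apply, ← htdef, key, map_mul, map_ofNat, Lam_three]
  rfl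

lemma not_three_dvd_one (Λ : 𝓞 L →+ ZMod 3) (hΛ : ∃ x, Λ x ≠ 0) : ¬ (3 : 𝓞 L) ∣ 1 := by
  rintro ⟨c, hc⟩
  obtain ⟨x, hx⟩ := hΛ
  apply hx
  rw [← one_mul x, hc, mul_assoc, Lam_three]

include h3 in
lemma no_omega (hone : ¬ (3 : 𝓞 L) ∣ 1) (x : 𝓞 L) (hx : x ^ 3 = 1) : x = 1 := by
  by_contra hne
  have h1 : x ^ 2 + x + 1 = 0 := by
    have : (x - 1) * (x ^ 2 + x + 1) = 0 := by linear_combination hx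
    rcases mul_eq_zero.1 this with h | h
    · exact absurd (sub_eq_zero.1 h) hne
    · exact h
  have h2 : (x - 1) ^ 2 = -3 * x := by linear_combination h1
  have h4 : (3 : 𝓞 L) ∣ x - 1 := by
    apply three_dvd_of_cube p L h3
    exact ⟨-x * (x - 1), by linear_combination (x - 1) * h2⟩
  obtain ⟨c, hc⟩ := h4
  apply hone
  have h3' : (3 : 𝓞 L) ≠ 0 := by norm_num
  have h5 : x = - 3 * c ^ 2 := by
    apply mul_left_cancel₀ h3'
    rw [hc] at h2
    linear_combination h2
  exact ⟨-c ^ 2 * x ^ 2, by rw [← hx]; linear_combination x ^ 2 * h5⟩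

end Cyc2

section Cyc3

open NumberField IsCyclotomicExtension Finset

variable (p : ℕ) [hpF : Fact p.Prime] (L : Type) [Field L] [NumberField L]
  [hcyc : IsCyclotomicExtension {p} ℚ L] (h3 : p % 3 = 2)

/-- The Galois action on units. -/
noncomputable def SSu (a : (ZMod p)ˣ) : (𝓞 L)ˣ →* (𝓞 L)ˣ := Units.map (SS p L a : 𝓞 L →* 𝓞 L)

lemma SSu_coe (a : (ZMod p)ˣ) (u : (𝓞 L)ˣ) : ((SSu p L a u : (𝓞 L)ˣ) : 𝓞 L) = SS p L a u := rfl

lemma SSu_mul (a b : (ZMod p)ˣ) (u : (𝓞 L)ˣ) : SSu p L (a * b) u = SSu p L a (SSu p L b u) := by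
  apply Units.ext
  rw [SSu_coe, SSu_coe, SSu_coe, SS_mul]

lemma exists_cu (a : (ZMod p)ˣ) : ∃ u : (𝓞 L)ˣ, (u : 𝓞 L) * (1 - zp p L 1) = 1 - zp p L a := by
  have h := (zt_prim p L).associated_sub_one_pow_sub_one_of_coprime (ZMod.val_coe_unit_coprime a)
  obtain ⟨u, hu⟩ := h
  refine ⟨u, ?_⟩
  rw [zp_one]
  have : zp p L a = zt p L ^ (a : ZMod p).val := rfl
  rw [this]
  linear_combination -hu

variable (H : Subgroup (ZMod p)ˣ) [Fintype H]

/-- The norm to the fixed field of `H`. -/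
noncomputable def NH (u : (𝓞 L)ˣ) : (𝓞 L)ˣ := ∏ η : H, SSu p L η u

lemma NH_fix (u : (𝓞 L)ˣ) (η : (ZMod p)ˣ) (hη : η ∈ H) : SSu p L η (NH p L H u) = NH p L H u := by
  unfold NH
  rw [map_prod]
  refine Fintype.prod_equiv (Equiv.mulLeft (⟨η, hη⟩ : H)) _ _ ?_
  intro x
  rw [← SSu_mul]; rfl

/-- The fixed field of `H`. -/
noncomputable def FH : IntermediateField ℚ L :=
  IntermediateField.fixedField (H.map (sig p L).toMonoidHom)

lemma mem_FH (x : L) : x ∈ FH p L H ↔ ∀ η ∈ H, sig p L η x = x := by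
  unfold FH
  rw [IntermediateField.mem_fixedField_iff]
  constructor
  · intro h η hη
    exact h _ (Subgroup.mem_map_of_mem _ hη)
  · rintro h _ ⟨η, hη, rfl⟩
    exact h η hη

lemma rank_FH : Units.rank (FH p L H) ≤ Nat.card ((ZMod p)ˣ ⧸ H) - 1 := by
  have : IsGalois ℚ L := IsCyclotomicExtension.isGalois {p} ℚ L
  have h1 : Module.finrank (FH p L H) L = Nat.card H := by
    unfold FH
    rw [IntermediateField.finrank_fixedField_eq_card]
    exact (Nat.card_congr (H.equivMapOfInjective _ (sig p L).injective).toEquiv).symm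
  have h2 : Module.finrank ℚ L = Nat.card (ZMod p)ˣ := by
    rw [IsCyclotomicExtension.Rat.finrank p L, Nat.card_eq_fintype_card, ZMod.card_units_eq_totient]
  have h4 := Module.finrank_mul_finrank ℚ (FH p L H) L
  have h5 := Subgroup.card_eq_card_quotient_mul_card_subgroup H
  have h6 : Module.finrank ℚ (FH p L H) = Nat.card ((ZMod p)ˣ ⧸ H) := by
    have hpos : 0 < Nat.card H := Nat.card_pos
    rw [h1, h2, h5] at h4
    exact Nat.eq_of_mul_eq_mul_right hpos h4
  have h7 := InfinitePlace.card_add_two_mul_card_eq_rank (FH p L H)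
  have h8 := InfinitePlace.card_eq_nrRealPlaces_add_nrComplexPlaces (FH p L H)
  unfold Units.rank
  omega

/-- The embedding of the units of the fixed field. -/
noncomputable def iF : (𝓞 (FH p L H))ˣ →* (𝓞 L)ˣ :=
  Units.map (algebraMap (𝓞 (FH p L H)) (𝓞 L) : 𝓞 (FH p L H) →* 𝓞 L)

lemma iF_coe (u : (𝓞 (FH p L H))ˣ) :
    ((iF p L H u : 𝓞 L) : L) = (((u : 𝓞 (FH p L H)) : FH p L H) : L) := rfl

lemma iF_inj : Function.Injective (iF p L H) := by
  intro u v huv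
  apply Units.ext
  apply RingOfIntegers.ext
  apply Subtype.ext
  rw [← iF_coe, ← iF_coe, huv]

lemma iF_fix (u : (𝓞 (FH p L H))ˣ) (η : (ZMod p)ˣ) (hη : η ∈ H) :
    SSu p L η (iF p L H u) = iF p L H u := by
  apply Units.ext
  apply RingOfIntegers.ext
  rw [SSu_coe, SS_coe, iF_coe]
  exact (mem_FH p L H _).1 (((u : 𝓞 (FH p L H)) : FH p L H)).2 η hη

lemma fix_descend (x : 𝓞 L) (hx : ∀ η ∈ H, SS p L η x = x) :
    ∃ y : 𝓞 (FH p L H), ((y : FH p L H) : L) = x := by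
  have hm : (x : L) ∈ FH p L H := by
    rw [mem_FH]
    intro η hη
    rw [← SS_coe, hx η hη]
  refine ⟨⟨⟨x, hm⟩, ?_⟩, rfl⟩
  have : IsIntegral ℤ ((FH p L H).val.toRingHom.toIntAlgHom ⟨x, hm⟩) := RingOfIntegers.isIntegral_coe x
  exact (isIntegral_algHom_iff (FH p L H).val.toRingHom.toIntAlgHom
    (FH p L H).val.toRingHom.injective).1 this

lemma iF_surj (u : (𝓞 L)ˣ) (hu : ∀ η ∈ H, SSu p L η u = u) : ∃ y, iF p L H y = u := by
  obtain ⟨y, hy⟩ := fix_descend p L H u (fun η hη => by rw [← SSu_coe, hu η hη])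
  obtain ⟨z, hz⟩ := fix_descend p L H ((u⁻¹ : (𝓞 L)ˣ) : 𝓞 L)
    (fun η hη => by rw [← SSu_coe, map_inv, hu η hη])
  have hyz : y * z = 1 := by
    apply RingOfIntegers.ext
    apply Subtype.ext
    have : (((y * z : 𝓞 (FH p L H)) : FH p L H) : L) = ((y : FH p L H) : L) * ((z : FH p L H) : L) := rfl
    rw [this, hy, hz, ← map_mul, Units.mul_inv]
    rfl
  refine ⟨⟨y, z, hyz, by rw [mul_comm, hyz]⟩, ?_⟩
  apply Units.ext
  apply RingOfIntegers.ext
  rw [iF_coe]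
  exact hy

variable (Λ : 𝓞 L →+ ZMod 3) (c0 : ZMod 3)
  (hΛ : ∀ b : (ZMod p)ˣ, Λ (ff p L b) = c0 + open Classical in if b ∈ H then 1 else 0)
  (hH : ((Nat.card H : ℕ) : ZMod 3) ≠ 0)

include hΛ in
open Classical in
lemma Psi_NH (u : (𝓞 L)ˣ) (a : (ZMod p)ˣ) (hu : (u : 𝓞 L) * (1 - zp p L 1) = 1 - zp p L a)
    (s : (ZMod p)ˣ) : Multiplicative.toAdd (Psi p L h3 Λ (NH p L H u)) s =
      Nat.card H * ((if s ∈ H then 1 else 0) - (if s * a ∈ H then 1 else 0)) := by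
  unfold NH
  rw [map_prod, toAdd_prod, Finset.sum_apply]
  have : ∀ η : H, Multiplicative.toAdd (Psi p L h3 Λ (SSu p L η u)) s =
      (if s ∈ H then 1 else 0) - (if s * a ∈ H then 1 else 0) := by
    intro η
    rw [Psi_frac p L h3 Λ (SSu p L η u) (η * a) η ?_ s, hΛ, hΛ]
    · have e1 : s * η ∈ H ↔ s ∈ H := Subgroup.mul_mem_cancel_right H η.2
      have e2 : s * (η * a) ∈ H ↔ s * a ∈ H := by
        rw [mul_left_comm]; exact Subgroup.mul_mem_cancel_left H η.2
      simp only [e1, e2]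
      ring
    · have h := congrArg (SS p L η) hu
      rw [map_mul, map_sub, map_sub, SS_zp, SS_zp, map_one, mul_one] at h
      rw [SSu_coe, Units.val_mul]; exact h
  rw [Finset.sum_congr rfl (fun η _ => this η), Finset.sum_const, Finset.card_univ,
    Nat.card_eq_fintype_card, nsmul_eq_mul]

include hΛ in
lemma Lam_ne (b : (ZMod p)ˣ) (hb : b ∉ H) : ∃ x, Λ x ≠ 0 := by
  by_contra hcon
  push Not at hcon
  have h1 := hΛ 1
  have h2 := hΛ b
  rw [hcon, if_pos H.one_mem] at h1
  rw [hcon, if_neg hb, add_zero] at h2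
  rw [← h2] at h1
  revert h1; decide

include hΛ hH in
/-- The key criterion: an `H`-invariant unit with trivial logarithm is the cube of one. -/
lemma cube_criterion (hone : ¬ (3 : 𝓞 L) ∣ 1) (x : (𝓞 L)ˣ) (hx : ∀ η ∈ H, SSu p L η x = x)
    (h0 : Psi p L h3 Λ x = 1) :
    ∃ κ : (𝓞 L)ˣ, (∀ η ∈ H, SSu p L η κ = κ) ∧ x = κ ^ 3 := by
  classical
  obtain ⟨x', hx'⟩ := iF_surj p L H x hx
  let φ : (𝓞 (FH p L H))ˣ →* Multiplicative ((ZMod p)ˣ → ZMod 3) := (Psi p L h3 Λ).comp (iF p L H)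
  let ι := {q : (ZMod p)ˣ ⧸ H // q ≠ ((1 : (ZMod p)ˣ) : (ZMod p)ˣ ⧸ H)}
  have hv : ∀ a : (ZMod p)ˣ, ∃ v : (𝓞 (FH p L H))ˣ, ∀ s,
      Multiplicative.toAdd (φ v) s =
      Nat.card H * ((if s ∈ H then 1 else 0) - (if s * a ∈ H then 1 else 0)) := by
    intro a
    obtain ⟨u, hu⟩ := exists_cu p L a
    obtain ⟨v, hv⟩ := iF_surj p L H (NH p L H u) (NH_fix p L H u)
    refine ⟨v, fun s => ?_⟩
    have : φ v = Psi p L h3 Λ (NH p L H u) := by rw [← hv]; rfl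
    rw [this, Psi_NH p L h3 H Λ c0 hΛ u a hu]
  choose v hv using hv
  obtain ⟨y, hy⟩ := abs_cube (Units.rank (FH p L H)) (Units.fundSystem (FH p L H)) (by
      intro x
      obtain ⟨⟨t, e⟩, hte, -⟩ := Units.exist_unique_eq_mul_prod (FH p L H) x
      have htor : IsOfFinOrder (t : (𝓞 (FH p L H))ˣ) := t.2
      have hcop : Nat.Coprime 3 (orderOf (t : (𝓞 (FH p L H))ˣ)) := by
        rw [Nat.Prime.coprime_iff_not_dvd Nat.prime_three]
        intro hdvd
        have ho := orderOf_pow_orderOf_div htor.orderOf_pos.ne' hdvd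
        set w := (t : (𝓞 (FH p L H))ˣ) ^ (orderOf (t : (𝓞 (FH p L H))ˣ) / 3)
        have hw3 : w ^ 3 = 1 := by rw [← ho]; exact pow_orderOf_eq_one w
        have hw1 : ((iF p L H w : (𝓞 L)ˣ) : 𝓞 L) = 1 := by
          apply no_omega p L h3 hone
          rw [← Units.val_pow_eq_pow_val, ← map_pow, hw3, map_one, Units.val_one]
        have hw : w = 1 := by
          apply iF_inj p L H
          apply Units.ext
          rw [hw1, map_one, Units.val_one]
        rw [hw, orderOf_one] at ho
        omega
      obtain ⟨j, hj⟩ := exists_pow_eq_self_of_coprime hcop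
      refine ⟨(t : (𝓞 (FH p L H))ˣ) ^ j, e, ?_⟩
      rw [← pow_mul, mul_comm j 3, pow_mul, hj]
      exact hte) φ (ι := ι) (by
      rw [← Nat.card_eq_fintype_card]
      refine (rank_FH p L H).trans ?_
      rw [Nat.card_eq_fintype_card, Nat.card_eq_fintype_card, Fintype.card_subtype_compl,
        Fintype.card_subtype_eq]) (fun q => v (q.1.out)) (by
      rw [Fintype.linearIndependent_iff]
      intro g hg q
      have h := congrFun hg ((q.1.out)⁻¹)
      rw [Finset.sum_apply] at h
      have hterm : ∀ r : ι, (g r • Multiplicative.toAdd (φ (v r.1.out))) ((q.1.out)⁻¹) =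
          if r = q then - (Nat.card H * g q) else 0 := by
        intro r
        rw [Pi.smul_apply, hv, smul_eq_mul]
        have hn : (q.1.out)⁻¹ ∉ H := by
          intro hm
          apply q.2
          rw [← QuotientGroup.out_eq' q.1, QuotientGroup.eq, mul_one]
          exact hm
        have hm : (q.1.out)⁻¹ * r.1.out ∈ H ↔ r = q := by
          rw [← QuotientGroup.eq, QuotientGroup.out_eq', QuotientGroup.out_eq', Subtype.ext_iff,
            eq_comm]
        rw [if_neg hn]
        simp only [hm]
        split_ifs with hrq
        · rw [hrq]; ring
        · ring
      rw [Finset.sum_congr rfl (fun r _ => hterm r), Finset.sum_ite_eq' ] at h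
      simp only [Finset.mem_univ, if_true, Pi.zero_apply, neg_eq_zero] at h
      exact (mul_eq_zero.1 h).resolve_left hH) x' (by rw [← h0, ← hx']; rfl)
  refine ⟨iF p L H y, iF_fix p L H y, ?_⟩
  rw [← hx', hy, map_pow]

end Cyc3

section NormBound

open NumberField

variable (K : Type) [Field K] [NumberField K]

lemma one_le_prod_norm (z : 𝓞 K) (hz : z ≠ 0) : 1 ≤ ∏ φ : K →ₐ[ℚ] ℂ, ‖φ (z : K)‖ := by
  have h1 := Algebra.norm_eq_prod_embeddings ℚ ℂ (z : K)
  have h2 : (Algebra.norm ℚ (z : K)) = ((Algebra.norm ℤ z : ℤ) : ℚ) := (Algebra.coe_norm_int z).symm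
  rw [← norm_prod, ← h1, h2]
  have h3 : Algebra.norm ℤ z ≠ 0 := Algebra.norm_ne_zero_iff.2 hz
  have h4 : (1 : ℤ) ≤ |Algebra.norm ℤ z| := Int.one_le_abs h3
  have h5 : ‖(algebraMap ℚ ℂ) ((Algebra.norm ℤ z : ℤ) : ℚ)‖ = ((|Algebra.norm ℤ z| : ℤ) : ℝ) := by
    simp
  rw [h5]
  exact_mod_cast h4

lemma norm_final (κ Bd A : 𝓞 K) (M : ℕ) (h3 : (3 : 𝓞 K) ∣ κ - 1) (hκ : κ ≠ 1)
    (hBd : Bd ≠ 0) (h : κ ^ M * Bd = A) (C : ℝ)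
    (hCA : ∀ φ : K →ₐ[ℚ] ℂ, ‖φ (A : K)‖ ≤ C) (hCB : ∀ φ : K →ₐ[ℚ] ℂ, ‖φ (Bd : K)‖ ≤ C) :
    (3 : ℝ) ^ M ≤ 2 ^ M * C := by
  obtain ⟨t, ht⟩ := h3
  have ht0 : t ≠ 0 := by
    rintro rfl
    apply hκ
    rw [mul_zero] at ht
    exact sub_eq_zero.1 ht
  set c := Fintype.card (K →ₐ[ℚ] ℂ) with hc
  have hc0 : c ≠ 0 := by
    rw [hc, AlgHom.card]; exact Module.finrank_pos.ne'
  have e1 : (3 : ℝ) ^ c ≤ ∏ φ : K →ₐ[ℚ] ℂ, (1 + ‖φ (κ : K)‖) := by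
    calc (3 : ℝ) ^ c ≤ 3 ^ c * ∏ φ : K →ₐ[ℚ] ℂ, ‖φ (t : K)‖ :=
          le_mul_of_one_le_right (by positivity) (one_le_prod_norm K t ht0)
      _ = ∏ φ : K →ₐ[ℚ] ℂ, (3 * ‖φ (t : K)‖) := by
          rw [Finset.prod_mul_distrib, Finset.prod_const, Finset.card_univ]
      _ ≤ _ := by
          apply Finset.prod_le_prod
          · intro φ _; positivity
          · intro φ _
            have hk : (κ : K) - 1 = 3 * (t : K) := by
              have := congrArg (algebraMap (𝓞 K) K) ht
              rw [map_sub, map_mul, map_one, map_ofNat] at this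
              exact this
            have : 3 * ‖φ (t : K)‖ = ‖φ (κ : K) - 1‖ := by
              rw [← map_one φ, ← map_sub, hk, map_mul, norm_mul, map_ofNat]; norm_num
            rw [this]
            calc ‖φ (κ : K) - 1‖ ≤ ‖φ (κ : K)‖ + ‖(1 : ℂ)‖ := norm_sub_le _ _
              _ = _ := by rw [norm_one, add_comm]
  have e2 : ∀ φ : K →ₐ[ℚ] ℂ, (1 + ‖φ (κ : K)‖) ^ M * ‖φ (Bd : K)‖ ≤ 2 ^ M * C := by
    intro φ
    have hC0 : 0 ≤ C := (norm_nonneg _).trans (hCA φ)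
    have h1 : φ (κ : K) ^ M * φ (Bd : K) = φ (A : K) := by
      rw [← map_pow, ← map_mul, ← h]; simp
    rcases Nat.eq_zero_or_pos M with rfl | hM
    · simpa using hCB φ
    have h2 : (1 + ‖φ (κ : K)‖) ^ M ≤ 2 ^ (M - 1) * (1 ^ M + ‖φ (κ : K)‖ ^ M) :=
      add_pow_le (by norm_num) (norm_nonneg _) M
    calc (1 + ‖φ (κ : K)‖) ^ M * ‖φ (Bd : K)‖
        ≤ 2 ^ (M - 1) * (1 ^ M + ‖φ (κ : K)‖ ^ M) * ‖φ (Bd : K)‖ :=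
          mul_le_mul_of_nonneg_right h2 (norm_nonneg _)
      _ = 2 ^ (M - 1) * (‖φ (Bd : K)‖ + ‖φ (A : K)‖) := by
          rw [← h1, norm_mul, norm_pow]; ring
      _ ≤ 2 ^ (M - 1) * (C + C) := by
          have := hCA φ
          have := hCB φ
          gcongr
      _ = 2 ^ M * C := by
          obtain ⟨N, rfl⟩ : ∃ N, M = N + 1 := ⟨M - 1, by omega⟩
          rw [Nat.add_sub_cancel, pow_succ]; ring
  have e3 : ((3 : ℝ) ^ M) ^ c ≤ (2 ^ M * C) ^ c := by
    calc ((3 : ℝ) ^ M) ^ c = (3 ^ c) ^ M := by rw [← pow_mul, ← pow_mul, mul_comm]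
      _ ≤ (∏ φ : K →ₐ[ℚ] ℂ, (1 + ‖φ (κ : K)‖)) ^ M := pow_le_pow_left₀ (by positivity) e1 M
      _ ≤ (∏ φ : K →ₐ[ℚ] ℂ, (1 + ‖φ (κ : K)‖)) ^ M * ∏ φ : K →ₐ[ℚ] ℂ, ‖φ (Bd : K)‖ :=
          le_mul_of_one_le_right (by positivity) (one_le_prod_norm K Bd hBd)
      _ = ∏ φ : K →ₐ[ℚ] ℂ, ((1 + ‖φ (κ : K)‖) ^ M * ‖φ (Bd : K)‖) := by
          rw [Finset.prod_mul_distrib, Finset.prod_pow]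
      _ ≤ ∏ φ : K →ₐ[ℚ] ℂ, (2 ^ M * C) := by
          apply Finset.prod_le_prod
          · intro φ _; positivity
          · intro φ _; exact e2 φ
      _ = _ := by rw [Finset.prod_const, Finset.card_univ]
  have hC0 : 0 ≤ C := by
    have : Nonempty (K →ₐ[ℚ] ℂ) := Fintype.card_pos_iff.1 (Nat.pos_of_ne_zero hc0)
    obtain ⟨φ⟩ := this
    exact (norm_nonneg _).trans (hCA φ)
  exact le_of_pow_le_pow_left₀ hc0 (by positivity) e3

end NormBound

section Cyc4

open NumberField IsCyclotomicExtension Finset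

variable (p : ℕ) [hpF : Fact p.Prime] (L : Type) [Field L] [NumberField L]
  [hcyc : IsCyclotomicExtension {p} ℚ L] (h3 : p % 3 = 2)
  (H : Subgroup (ZMod p)ˣ) [Fintype H]
  (Λ : 𝓞 L →+ ZMod 3) (c0 : ZMod 3)
  (hΛ : ∀ b : (ZMod p)ˣ, Λ (ff p L b) = c0 + open Classical in if b ∈ H then 1 else 0)
  (hH : ((Nat.card H : ℕ) : ZMod 3) ≠ 0)

include h3 hΛ hH in
lemma power_descent (hone : ¬ (3 : 𝓞 L) ∣ 1) (k : ℕ) : ∀ (x : (𝓞 L)ˣ),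
    (∀ η ∈ H, SSu p L η x = x) → (3 : 𝓞 L) ^ (k + 1) ∣ (x : 𝓞 L) - 1 →
    ∃ κ : (𝓞 L)ˣ, x = κ ^ 3 ^ k ∧ (3 : 𝓞 L) ∣ (κ : 𝓞 L) - 1 := by
  induction k with
  | zero => intro x _ hx; exact ⟨x, by simp, by simpa using hx⟩
  | succ k ih =>
    intro x hfix hx
    have h9 : (9 : 𝓞 L) ∣ (x : 𝓞 L) - 1 := by
      refine Dvd.dvd.trans ⟨3 ^ k, ?_⟩ hx
      ring
    obtain ⟨y, hyfix, hxy⟩ := cube_criterion p L h3 H Λ c0 hΛ hH hone x hfix (Psi_nine p L h3 Λ x h9)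
    have hy3 : (3 : 𝓞 L) ∣ (y : 𝓞 L) - 1 := by
      apply three_dvd_of_cube_sub p L h3
      rw [← Units.val_pow_eq_pow_val, ← hxy]
      exact Dvd.dvd.trans ⟨3, by norm_num⟩ h9
    obtain ⟨t, ht⟩ := hy3
    have hyt : (y : 𝓞 L) = 1 + 3 * t := by linear_combination ht
    have h1 : (3 : 𝓞 L) ^ k ∣ t * (1 + 3 * (t + t ^ 2)) := by
      have h90 : (9 : 𝓞 L) ≠ 0 := by norm_num
      rw [← mul_dvd_mul_iff_left h90]
      have : (x : 𝓞 L) - 1 = 9 * (t * (1 + 3 * (t + t ^ 2))) := by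
        rw [hxy, Units.val_pow_eq_pow_val, hyt]; ring
      rw [← this]
      convert hx using 1; ring
    have h2 : (3 : 𝓞 L) ^ k ∣ t := by
      refine IsCoprime.dvd_of_dvd_mul_right ?_ h1
      apply IsCoprime.pow_left
      exact ⟨-(t + t ^ 2), 1, by ring⟩
    obtain ⟨κ, hκ, hκ3⟩ := ih y hyfix (by
      rw [ht, pow_succ, mul_comm]; exact mul_dvd_mul_left 3 h2)
    refine ⟨κ, ?_, hκ3⟩
    rw [hxy, hκ, ← pow_mul, ← pow_succ]

end Cyc4

lemma prod_one_add_expand {R ι : Type*} [CommRing R] (s : Finset ι) (c : R) (f : ι → R) :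
    ∃ r, ∏ i ∈ s, (1 + c * f i) = 1 + c * ∑ i ∈ s, f i + c ^ 2 * r := by
  classical
  induction s using Finset.induction_on with
  | empty => exact ⟨0, by simp⟩
  | insert a s ha ih =>
    obtain ⟨r, hr⟩ := ih
    rw [Finset.prod_insert ha, Finset.sum_insert ha, hr]
    exact ⟨f a * ∑ i ∈ s, f i + r + c * f a * r, by ring⟩

lemma prod_range_root (p : ℕ) (hp : 0 < p) (z a b : ℂ) (hz : IsPrimitiveRoot z p) :
    ∏ k ∈ Finset.range p, (a - z ^ k * b) = a ^ p - b ^ p := by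
  rw [hz.pow_sub_pow_eq_prod_sub_mul a b hp]
  apply Finset.prod_nbij (fun k => z ^ k)
  · intro k _
    rw [Polynomial.mem_nthRootsFinset hp, ← pow_mul, mul_comm, pow_mul, hz.pow_eq_one, one_pow]
  · intro i hi j hj hij
    exact hz.pow_inj (by simpa using hi) (by simpa using hj) hij
  · intro x hx
    have hx' : x ^ p = 1 := by simpa [Polynomial.mem_nthRootsFinset hp] using hx
    have : NeZero p := ⟨hp.ne'⟩
    obtain ⟨i, hi, rfl⟩ := hz.eq_pow_of_pow_eq_one hx'
    exact ⟨i, by simpa using hi, rfl⟩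
  · intro k _; rfl

lemma prod_eps_complex (q n : ℕ) (hq : q = 2 * n) (w d y : ℤ) (hd : d ≠ 0)
    (hy : w ^ 2 + d ^ 2 = 2 * y)
    (him : ((⟨w, d⟩ : GaussianInt) ^ (q + 1)).im = 2 ^ n * d ∨
      ((⟨w, d⟩ : GaussianInt) ^ (q + 1)).im = -(2 ^ n * d))
    (z : ℂ) (hz : IsPrimitiveRoot z (q + 1)) :
    ∏ k ∈ Finset.range q, (((w ^ 2 - d ^ 2 : ℤ) : ℂ) - (y : ℂ) * (z ^ (k + 1) + z⁻¹ ^ (k + 1))) = 1 := by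
  set a : ℂ := w + d * Complex.I with ha
  set b : ℂ := w - d * Complex.I with hb
  have hI : Complex.I ^ 2 = -1 := Complex.I_sq
  have hyC : (w : ℂ) ^ 2 + d ^ 2 = 2 * y := by exact_mod_cast congrArg (Int.cast : ℤ → ℂ) hy
  have hdC : (d : ℂ) ≠ 0 := by exact_mod_cast hd
  have hga : a = GaussianInt.toComplex ⟨w, d⟩ := by rw [GaussianInt.toComplex_def₂]; rw [ha]; apply Complex.ext <;> simp
  have hgb : b = (starRingEnd ℂ) a := by rw [ha, hb]; simp [sub_eq_add_neg]
  have hdiff : a ^ (q + 1) - b ^ (q + 1) =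
      2 * Complex.I * ((((⟨w, d⟩ : GaussianInt) ^ (q + 1)).im : ℤ) : ℂ) := by
    rw [hgb, ← map_pow, Complex.sub_conj, hga, ← map_pow, ← GaussianInt.intCast_im]
    push_cast; ring
  have key : ∀ x : ℂ, IsPrimitiveRoot x (q + 1) →
      (∏ k ∈ Finset.range q, (a - x ^ (k + 1) * b)) = 2 ^ n ∨
      (∏ k ∈ Finset.range q, (a - x ^ (k + 1) * b)) = - 2 ^ n := by
    intro x hx
    have h := prod_range_root (q + 1) (by omega) x a b hx
    rw [Finset.prod_range_succ', hdiff, pow_zero, one_mul] at h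
    have hab : a - b = 2 * d * Complex.I := by rw [ha, hb]; ring
    rw [hab] at h
    have hne : 2 * (d : ℂ) * Complex.I ≠ 0 := by
      simp [hdC]
    rcases him with e | e
    · left
      apply mul_right_cancel₀ hne
      rw [h, e]; push_cast; ring
    · right
      apply mul_right_cancel₀ hne
      rw [h, e]; push_cast; ring
  have hz0 : z ≠ 0 := hz.ne_zero (by omega)
  have hprod : ∏ k ∈ Finset.range q, (2 * (((w ^ 2 - d ^ 2 : ℤ) : ℂ) - (y : ℂ) * (z ^ (k + 1) + z⁻¹ ^ (k + 1))))
      = (∏ k ∈ Finset.range q, (a - z ^ (k + 1) * b)) * ∏ k ∈ Finset.range q, (a - z⁻¹ ^ (k + 1) * b) := by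
    rw [← Finset.prod_mul_distrib]
    apply Finset.prod_congr rfl
    intro k _
    have h1 : z ^ (k + 1) * z⁻¹ ^ (k + 1) = 1 := by rw [← mul_pow, mul_inv_cancel₀ hz0, one_pow]
    have h2 : a * b = 2 * y := by rw [ha, hb, ← hyC]; linear_combination (-(d : ℂ) ^ 2) * hI
    have h3 : a ^ 2 + b ^ 2 = 2 * ((w : ℂ) ^ 2 - d ^ 2) := by
      rw [ha, hb]; linear_combination (2 * (d : ℂ) ^ 2) * hI
    push_cast
    linear_combination -h3 + (z ^ (k + 1) + z⁻¹ ^ (k + 1)) * h2 - b ^ 2 * h1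
  rw [Finset.prod_mul_distrib, Finset.prod_const, Finset.card_range] at hprod
  have h4 : (2 : ℂ) ^ q ≠ 0 := pow_ne_zero _ two_ne_zero
  have hq2 : (2 : ℂ) ^ q = 2 ^ n * 2 ^ n := by rw [hq, two_mul, pow_add]
  -- signs: both products agree up to sign; they are equal by reindexing
  have hsame : ∏ k ∈ Finset.range q, (a - z⁻¹ ^ (k + 1) * b) = ∏ k ∈ Finset.range q, (a - z ^ (k + 1) * b) := by
    have e1 := prod_range_root (q + 1) (by omega) z a b hz
    have e2 := prod_range_root (q + 1) (by omega) z⁻¹ a b hz.inv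
    rw [← e2, Finset.prod_range_succ', Finset.prod_range_succ', pow_zero, pow_zero] at e1
    have hab : a - 1 * b = 2 * d * Complex.I := by rw [ha, hb]; ring
    have hne : 2 * (d : ℂ) * Complex.I ≠ 0 := by
      simp [hdC]
    rw [hab] at e1
    exact (mul_right_cancel₀ hne e1).symm
  rw [hsame] at hprod
  apply mul_left_cancel₀ h4
  rw [hprod, mul_one, hq2]
  rcases key z hz with h | h <;> rw [h] <;> ring

section Cyc5

open NumberField IsCyclotomicExtension Finset

variable (p : ℕ) [hpF : Fact p.Prime] (L : Type) [Field L] [NumberField L]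
  [hcyc : IsCyclotomicExtension {p} ℚ L] (h3 : p % 3 = 2)

/-- The elements `V - y (ζ^a + ζ^(-a))`. -/
noncomputable def eps (V y : ℤ) (a : ZMod p) : 𝓞 L := (V : 𝓞 L) - y * (zp p L a + zp p L (-a))

/-- The elements `(1 - ζ^a) (1 - ζ^(-a))`. -/
noncomputable def ppi (a : ZMod p) : 𝓞 L := 2 - (zp p L a + zp p L (-a))

lemma zp_neg_mul (a : ZMod p) : zp p L a * zp p L (-a) = 1 := by
  rw [← zp_add, add_neg_cancel, zp_zero]

lemma SS_eps (V y : ℤ) (b : (ZMod p)ˣ) (a : ZMod p) :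
    SS p L b (eps p L V y a) = eps p L V y (b * a) := by
  unfold eps
  rw [map_sub, map_mul, map_add, map_intCast, map_intCast, SS_zp, SS_zp, mul_neg]

lemma SS_ppi (b : (ZMod p)ˣ) (a : ZMod p) : SS p L b (ppi p L a) = ppi p L (b * a) := by
  unfold ppi
  rw [map_sub, map_add, map_ofNat, SS_zp, SS_zp, mul_neg]

lemma ppi_eq (a : ZMod p) : ppi p L a = (1 - zp p L a) * (1 - zp p L (-a)) := by
  unfold ppi
  linear_combination -zp_neg_mul p L a

include h3 in
lemma ff_ppi (a : (ZMod p)ˣ) : ff p L a * ppi p L a = 3 * ff p L a - 1 := by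
  have h1 := ff_mul p L h3 a
  have h2 := zp_neg_mul p L a
  have h3' : zp p L a - 1 ≠ 0 := sub_ne_zero.2 (zp_ne_one p L a)
  have h4 : ff p L a * (zp p L a ^ 2 + zp p L a + 1) = zp p L a := by
    apply mul_left_cancel₀ h3'
    linear_combination h1
  unfold ppi
  linear_combination (-zp p L (-a)) * h4 + (ff p L a * zp p L a + ff p L a - 1) * h2

lemma eps_unit (n : ℕ) (hpn : p = 2 * n + 1) (w d y : ℤ) (hd : d ≠ 0)
    (hy : w ^ 2 + d ^ 2 = 2 * y)
    (him : ((⟨w, d⟩ : GaussianInt) ^ p).im = 2 ^ n * d ∨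
      ((⟨w, d⟩ : GaussianInt) ^ p).im = -(2 ^ n * d)) :
    IsUnit (eps p L (w ^ 2 - d ^ 2) y 1) := by
  obtain ⟨φ⟩ : Nonempty (L →+* ℂ) := inferInstance
  set ψ : 𝓞 L →+* ℂ := φ.comp (algebraMap (𝓞 L) L) with hψ
  have hinj : Function.Injective ψ := φ.injective.comp RingOfIntegers.coe_injective
  have hz : IsPrimitiveRoot (ψ (zt p L)) p := (zt_prim p L).map_of_injective hinj
  have hz0 : ψ (zt p L) ≠ 0 := hz.ne_zero hpF.out.ne_zero
  have h := prod_eps_complex (2 * n) n rfl w d y hd hy (by rw [← hpn]; exact him) (ψ (zt p L))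
    (by rw [← hpn]; exact hz)
  have h2 : ∏ k ∈ range (2 * n), eps p L (w ^ 2 - d ^ 2) y ((k + 1 : ℕ) : ZMod p) = 1 := by
    apply hinj
    rw [map_prod, map_one, ← h]
    apply prod_congr rfl
    intro k _
    have e : ψ (zp p L (-((k + 1 : ℕ) : ZMod p))) = (ψ (zt p L))⁻¹ ^ (k + 1) := by
      have h3 := congrArg ψ (zp_neg_mul p L ((k + 1 : ℕ) : ZMod p))
      rw [map_mul, map_one, zp_natCast, map_pow] at h3
      rw [inv_pow]
      exact eq_inv_of_mul_eq_one_right h3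
    unfold eps
    rw [map_sub, map_mul, map_add, map_intCast, map_intCast, e, zp_natCast, map_pow]
  have hn : 0 < n := by
    have := hpF.out.two_le
    omega
  have h3 : eps p L (w ^ 2 - d ^ 2) y ((0 + 1 : ℕ) : ZMod p) ∣ 1 := by
    rw [← h2]
    exact dvd_prod_of_mem (fun k : ℕ => eps p L (w ^ 2 - d ^ 2) y ((k + 1 : ℕ) : ZMod p)) (mem_range.2 (by omega))
  rw [zero_add, Nat.cast_one] at h3
  exact isUnit_of_dvd_one h3

lemma norm_zp (φ : L →ₐ[ℚ] ℂ) (a : ZMod p) : ‖φ ((zp p L a : 𝓞 L) : L)‖ = 1 := by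
  have h : (φ ((zp p L a : 𝓞 L) : L)) ^ p = 1 := by
    rw [← map_pow, ← map_one φ]
    congr 1
    exact_mod_cast congrArg (algebraMap (𝓞 L) L) (zp_pow_p p L a)
  exact Complex.norm_eq_one_of_pow_eq_one h hpF.out.ne_zero

lemma norm_ppi (φ : L →ₐ[ℚ] ℂ) (a : ZMod p) : ‖φ ((ppi p L a : 𝓞 L) : L)‖ ≤ 4 := by
  have : φ ((ppi p L a : 𝓞 L) : L) =
      2 - (φ ((zp p L a : 𝓞 L) : L) + φ ((zp p L (-a) : 𝓞 L) : L)) := by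
    unfold ppi
    simp only [map_sub, map_add, map_ofNat]
  rw [this]
  calc _ ≤ ‖(2 : ℂ)‖ + ‖φ ((zp p L a : 𝓞 L) : L) + φ ((zp p L (-a) : 𝓞 L) : L)‖ := norm_sub_le _ _
    _ ≤ ‖(2 : ℂ)‖ + (‖φ ((zp p L a : 𝓞 L) : L)‖ + ‖φ ((zp p L (-a) : 𝓞 L) : L)‖) := by
        gcongr; exact norm_add_le _ _
    _ = 4 := by rw [norm_zp, norm_zp]; norm_num

lemma norm_eps (V y : ℤ) (hV : |V| ≤ 2 * y) (φ : L →ₐ[ℚ] ℂ) (a : ZMod p) :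
    ‖φ ((eps p L V y a : 𝓞 L) : L)‖ ≤ 4 * y := by
  have hy : 0 ≤ y := by have := abs_nonneg V; omega
  have : φ ((eps p L V y a : 𝓞 L) : L) =
      V - y * (φ ((zp p L a : 𝓞 L) : L) + φ ((zp p L (-a) : 𝓞 L) : L)) := by
    unfold eps
    simp only [map_sub, map_add, map_mul, map_intCast]
  rw [this]
  calc _ ≤ ‖(V : ℂ)‖ + ‖(y : ℂ) * (φ ((zp p L a : 𝓞 L) : L) + φ ((zp p L (-a) : 𝓞 L) : L))‖ := norm_sub_le _ _
    _ ≤ ‖(V : ℂ)‖ + ‖(y : ℂ)‖ * (‖φ ((zp p L a : 𝓞 L) : L)‖ + ‖φ ((zp p L (-a) : 𝓞 L) : L)‖) := by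
        rw [norm_mul]
        gcongr; exact norm_add_le _ _
    _ ≤ 4 * y := by
        rw [norm_zp, norm_zp, Complex.norm_intCast, Complex.norm_intCast]
        have h1 : |(V : ℝ)| ≤ 2 * y := by exact_mod_cast hV
        have h2 : |(y : ℝ)| = y := abs_of_nonneg (by exact_mod_cast hy)
        rw [h2]; linarith

end Cyc5

section Cyc6

open NumberField IsCyclotomicExtension Finset

variable (p : ℕ) [hpF : Fact p.Prime] (L : Type) [Field L] [NumberField L]
  [hcyc : IsCyclotomicExtension {p} ℚ L] (h3 : p % 3 = 2)
  (H : Subgroup (ZMod p)ˣ) [Fintype H]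
  (Λ : 𝓞 L →+ ZMod 3) (c0 : ZMod 3)
  (hΛ : ∀ b : (ZMod p)ˣ, Λ (ff p L b) = c0 + open Classical in if b ∈ H then 1 else 0)
  (hH : ((Nat.card H : ℕ) : ZMod 3) ≠ 0)

/-- The units `ξ` and their basic properties. -/
lemma exists_xi (w d y : ℤ) (hy : w ^ 2 + d ^ 2 = 2 * y)
    (hu : IsUnit (eps p L (w ^ 2 - d ^ 2) y 1)) (a : (ZMod p)ˣ) :
    ∃ ξ : (𝓞 L)ˣ, ∃ θ : 𝓞 L, (ξ : 𝓞 L) = 1 + (d : 𝓞 L) ^ 2 * θ ∧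
      (ξ : 𝓞 L) * (eps p L (w ^ 2 - d ^ 2) y 1 * ppi p L a) =
        eps p L (w ^ 2 - d ^ 2) y a * ppi p L 1 ∧
      θ * (eps p L (w ^ 2 - d ^ 2) y 1 * ppi p L a) = 2 * (ppi p L a - ppi p L 1) := by
  obtain ⟨e1, he1⟩ := hu
  obtain ⟨u, hu⟩ := exists_cu p L a
  have hea : ((SSu p L a e1 : (𝓞 L)ˣ) : 𝓞 L) = eps p L (w ^ 2 - d ^ 2) y a := by
    rw [SSu_coe, he1, SS_eps, mul_one]
  have hu' : ((SSu p L (-1) u : (𝓞 L)ˣ) : 𝓞 L) * (1 - zp p L (-1)) = 1 - zp p L (-a) := by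
    have := congrArg (SS p L (-1)) hu
    rw [map_mul, map_sub, map_sub, map_one, SS_zp, SS_zp] at this
    rw [SSu_coe]
    simpa using this
  set u' := SSu p L (-1) u
  set ea := SSu p L a e1
  set v := u * u' with hv
  have hvπ : (v : 𝓞 L) * ppi p L 1 = ppi p L a := by
    rw [ppi_eq, ppi_eq, hv, Units.val_mul, ← hu, ← hu']; ring
  have hyL : (w : 𝓞 L) ^ 2 + (d : 𝓞 L) ^ 2 = 2 * y := by
    exact_mod_cast congrArg (Int.cast : ℤ → 𝓞 L) hy
  have hkey : eps p L (w ^ 2 - d ^ 2) y a * ppi p L 1 - eps p L (w ^ 2 - d ^ 2) y 1 * ppi p L a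
      = 2 * (d : 𝓞 L) ^ 2 * (ppi p L a - ppi p L 1) := by
    unfold eps ppi
    push_cast
    linear_combination (zp p L a + zp p L (-a) - zp p L 1 - zp p L (-1)) * hyL
  have hπ1 : ppi p L 1 ≠ 0 := by
    rw [ppi_eq]
    have h1 := zp_ne_one p L 1
    have h2 := zp_ne_one p L (-1)
    rw [Units.val_one] at h1
    rw [Units.val_neg, Units.val_one] at h2
    exact mul_ne_zero (sub_ne_zero.2 h1.symm) (sub_ne_zero.2 h2.symm)
  have i1 : ((e1⁻¹ : (𝓞 L)ˣ) : 𝓞 L) * e1 = 1 := by simp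
  have i2 : ((v⁻¹ : (𝓞 L)ˣ) : 𝓞 L) * v = 1 := by simp
  have hkey' : (ea : 𝓞 L) - e1 * v = 2 * (d : 𝓞 L) ^ 2 * (v - 1) := by
    apply mul_right_cancel₀ hπ1
    rw [hea, he1]
    linear_combination hkey + (-2 * (d : 𝓞 L) ^ 2 - eps p L (w ^ 2 - d ^ 2) y 1) * hvπ
  refine ⟨ea * e1⁻¹ * v⁻¹, 2 * (v - 1) * ((e1⁻¹ : (𝓞 L)ˣ) : 𝓞 L) * ((v⁻¹ : (𝓞 L)ˣ) : 𝓞 L), ?_, ?_, ?_⟩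
  · rw [Units.val_mul, Units.val_mul]
    have : (ea : 𝓞 L) = e1 * v + 2 * (d : 𝓞 L) ^ 2 * (v - 1) := by linear_combination hkey'
    rw [this]
    linear_combination ((v : 𝓞 L) * ((v⁻¹ : (𝓞 L)ˣ) : 𝓞 L)) * i1 + i2
  · rw [Units.val_mul, Units.val_mul, ← he1, ← hvπ, ← hea]
    linear_combination ((ea : 𝓞 L) * ((v⁻¹ : (𝓞 L)ˣ) : 𝓞 L) * v * ppi p L 1) * i1 + (ea : 𝓞 L) * ppi p L 1 * i2
  · rw [← he1, ← hvπ]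
    linear_combination (2 * ((v : 𝓞 L) - 1) * ((v⁻¹ : (𝓞 L)ˣ) : 𝓞 L) * v * ppi p L 1) * i1
      + 2 * ((v : 𝓞 L) - 1) * ppi p L 1 * i2

include h3 in
/-- The unit `θ` modulo three. -/
lemma theta_mod (w d y : ℤ) (hy : w ^ 2 + d ^ 2 = 2 * y) (hw : ¬ (3 : ℤ) ∣ w) (hd : (3 : ℤ) ∣ d)
    (a : (ZMod p)ˣ) (θ : 𝓞 L)
    (hθ : θ * (eps p L (w ^ 2 - d ^ 2) y 1 * ppi p L a) = 2 * (ppi p L a - ppi p L 1)) :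
    ∃ r : 𝓞 L, θ = ff p L a - ff p L 1 + 3 * r := by
  obtain ⟨d', rfl⟩ := hd
  obtain ⟨W', hW'⟩ : ∃ W' : ℤ, w ^ 2 = 1 + 3 * W' := by
    have h : w % 3 = 1 ∨ w % 3 = 2 := by omega
    rcases h with h | h
    · exact ⟨3 * (w / 3) ^ 2 + 2 * (w / 3), by
        have : w = 3 * (w / 3) + 1 := by omega
        nth_rewrite 1 [this]; ring⟩
    · exact ⟨3 * (w / 3) ^ 2 + 4 * (w / 3) + 1, by
        have : w = 3 * (w / 3) + 2 := by omega
        nth_rewrite 1 [this]; ring⟩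
  have hyL : (w : 𝓞 L) ^ 2 + (3 * (d' : 𝓞 L)) ^ 2 = 2 * y := by
    exact_mod_cast congrArg (Int.cast : ℤ → 𝓞 L) hy
  have hWL : (w : 𝓞 L) ^ 2 = 1 + 3 * (W' : 𝓞 L) := by
    exact_mod_cast congrArg (Int.cast : ℤ → 𝓞 L) hW'
  have he : ∃ r, 2 * eps p L (w ^ 2 - (3 * d') ^ 2) y 1 = ppi p L 1 + 3 * r := by
    refine ⟨W' * ppi p L 1 - 3 * (d' : 𝓞 L) ^ 2 * (2 + (zp p L 1 + zp p L (-1))), ?_⟩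
    unfold eps ppi
    push_cast
    linear_combination (zp p L 1 + zp p L (-1)) * hyL
      + (2 - 2 * (zp p L 1 + zp p L (-1)) + (zp p L 1 + zp p L (-1))) * hWL
  obtain ⟨r, hr⟩ := he
  have f1 := ff_ppi p L h3 1
  have fa := ff_ppi p L h3 a
  rw [Units.val_one] at f1
  set F1 := ff p L 1
  set Fa := ff p L a
  set P1 := ppi p L 1
  set Pa := ppi p L a
  set E := eps p L (w ^ 2 - (3 * d') ^ 2) y 1
  -- θ P1 Pa + 3 r θ Pa = 4 (Pa - P1)
  have h4 : θ * P1 * Pa = 4 * (Pa - P1) - 3 * r * θ * Pa := by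
    linear_combination 2 * hθ - θ * Pa * hr
  have h5 : θ * (3 * F1 - 1) * (3 * Fa - 1) =
      4 * ((3 * Fa - 1) * F1 - (3 * F1 - 1) * Fa) - 3 * r * θ * (3 * Fa - 1) * F1 := by
    rw [← f1, ← fa]
    linear_combination (F1 * Fa) * h4
  refine ⟨Fa - F1 - r * θ * (3 * Fa - 1) * F1 - θ * (3 * F1 * Fa - F1 - Fa), ?_⟩
  linear_combination h5

include h3 hΛ hH in
lemma cyc_main (n : ℕ) (hpn : p = 2 * n + 1) (a : (ZMod p)ˣ) (ha : a ∉ H) (m : ℕ) (hm : 0 < m)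
    (w y : ℤ) (hw : ¬ (3 : ℤ) ∣ w) (hy : w ^ 2 + (3 ^ m) ^ 2 = 2 * y)
    (him : ((⟨w, 3 ^ m⟩ : GaussianInt) ^ p).im = 2 ^ n * 3 ^ m ∨
      ((⟨w, 3 ^ m⟩ : GaussianInt) ^ p).im = -(2 ^ n * 3 ^ m)) :
    (3 : ℝ) ^ (3 ^ (2 * m - 1)) ≤ 2 ^ (3 ^ (2 * m - 1)) * (16 * (y : ℝ)) ^ Fintype.card H := by
  have hone := not_three_dvd_one L Λ (Lam_ne p L H Λ c0 hΛ a ha)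
  have hd0 : (3 : ℤ) ^ m ≠ 0 := by positivity
  have hd3 : (3 : ℤ) ∣ 3 ^ m := dvd_pow_self 3 hm.ne'
  have hunit := eps_unit p L n hpn w (3 ^ m) y hd0 hy him
  obtain ⟨ξ, θ, hξ, hξA, hθ⟩ := exists_xi p L w (3 ^ m) y hy hunit a
  obtain ⟨r, hr⟩ := theta_mod p L h3 w (3 ^ m) y hy hw hd3 a θ hθ
  set x := NH p L H ξ with hx
  set c : 𝓞 L := (((3 : ℤ) ^ m : ℤ) : 𝓞 L) ^ 2 with hc
  have hc' : c = 3 ^ (2 * m) := by rw [hc]; push_cast; rw [← pow_mul, mul_comm]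
  have hxprod : (x : 𝓞 L) = ∏ η : H, (1 + c * SS p L (η : (ZMod p)ˣ) θ) := by
    rw [hx, NH, Units.coe_prod]
    apply prod_congr rfl
    intro η _
    rw [SSu_coe, hξ, map_add, map_mul, map_one, hc, map_pow, map_intCast]
  obtain ⟨q, hq⟩ := prod_one_add_expand (univ : Finset H) c (fun η => SS p L (η : (ZMod p)ˣ) θ)
  rw [← hxprod] at hq
  have hdvd : (3 : 𝓞 L) ^ (2 * m - 1 + 1) ∣ (x : 𝓞 L) - 1 := by
    have : 2 * m - 1 + 1 = 2 * m := by omega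
    rw [this, ← hc', hq]
    exact ⟨∑ η : H, SS p L (η : (ZMod p)ˣ) θ + c * q, by ring⟩
  obtain ⟨κ, hκ, hκ3⟩ := power_descent p L h3 H Λ c0 hΛ hH hone (2 * m - 1) x
    (fun η hη => NH_fix p L H ξ η hη) hdvd
  have hx1 : x ≠ 1 := by
    intro h1
    rw [h1, Units.val_one] at hq
    have hc0 : c ≠ 0 := by rw [hc']; exact pow_ne_zero _ (by norm_num)
    have hsum : ∑ η : H, SS p L (η : (ZMod p)ˣ) θ = 3 * (- 3 ^ (2 * m - 1) * q) := by
      apply mul_left_cancel₀ hc0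
      have : c = 3 * 3 ^ (2 * m - 1) := by
        rw [hc', ← pow_succ']; congr 1; omega
      have e2 : c * (3 * (- 3 ^ (2 * m - 1) * q)) = c * (-(3 * 3 ^ (2 * m - 1)) * q) := by ring
      rw [e2, ← this]
      linear_combination -hq
    have h2 := congrArg Λ hsum
    rw [Lam_three, map_sum] at h2
    have h4 : ∀ η : H, Λ (SS p L (η : (ZMod p)ˣ) θ) = -1 := by
      intro η
      rw [hr, map_add, map_sub, map_mul, map_ofNat, map_add, map_sub, Lam_three, add_zero, SS_ff, SS_ff, mul_one,
        ← Units.val_mul, hΛ, hΛ]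
      have m1 : (η : (ZMod p)ˣ) ∈ H := η.2
      have m2 : (η : (ZMod p)ˣ) * a ∉ H := fun h => ha ((H.mul_mem_cancel_left m1).1 h)
      rw [if_pos m1, if_neg m2]; ring
    rw [sum_congr rfl (fun η _ => h4 η), sum_const, card_univ, ← Nat.card_eq_fintype_card] at h2
    apply hH
    have : (Nat.card H) • (-1 : ZMod 3) = -((Nat.card H : ℕ) : ZMod 3) := by simp
    rw [this] at h2
    exact neg_eq_zero.1 h2
  have hκ1 : (κ : 𝓞 L) ≠ 1 := by
    intro h
    apply hx1
    rw [hκ, Units.val_eq_one.1 h, one_pow]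
  set V : ℤ := w ^ 2 - (3 ^ m) ^ 2 with hV
  set Bd : 𝓞 L := ∏ η : H, SS p L (η : (ZMod p)ˣ) (eps p L V y 1 * ppi p L a) with hBd
  set A : 𝓞 L := ∏ η : H, SS p L (η : (ZMod p)ˣ) (eps p L V y a * ppi p L 1) with hA
  have hAB : (κ : 𝓞 L) ^ (3 ^ (2 * m - 1)) * Bd = A := by
    rw [← Units.val_pow_eq_pow_val, ← hκ, hx, NH, Units.coe_prod, hBd, hA, ← prod_mul_distrib]
    apply prod_congr rfl
    intro η _
    rw [SSu_coe, ← map_mul, hξA]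
  have hBd0 : Bd ≠ 0 := by
    rw [hBd, prod_ne_zero_iff]
    intro η _
    rw [Ne, map_eq_zero_iff _ (SS p L (η : (ZMod p)ˣ)).injective]
    refine mul_ne_zero hunit.ne_zero ?_
    rw [ppi_eq]
    have h1 := zp_ne_one p L a
    have h2 := zp_ne_one p L (-a)
    rw [Units.val_neg] at h2
    exact mul_ne_zero (sub_ne_zero.2 h1.symm) (sub_ne_zero.2 h2.symm)
  have hVy : |V| ≤ 2 * y := by
    rw [abs_le, hV, ← hy]
    constructor <;> nlinarith [sq_nonneg w, sq_nonneg ((3 : ℤ) ^ m)]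
  have hb : ∀ (φ : L →ₐ[ℚ] ℂ) (s t : ZMod p),
      ‖φ (((∏ η : H, SS p L (η : (ZMod p)ˣ) (eps p L V y s * ppi p L t) : 𝓞 L)) : L)‖
        ≤ (16 * (y : ℝ)) ^ Fintype.card H := by
    intro φ s t
    have e : φ (((∏ η : H, SS p L (η : (ZMod p)ˣ) (eps p L V y s * ppi p L t) : 𝓞 L)) : L)
        = ∏ η : H, (φ ((eps p L V y ((η : (ZMod p)ˣ) * s) : 𝓞 L) : L) *
          φ ((ppi p L ((η : (ZMod p)ˣ) * t) : 𝓞 L) : L)) := by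
      refine (map_prod ((φ : L →+* ℂ).comp (algebraMap (𝓞 L) L))
        (fun η : H => SS p L (η : (ZMod p)ˣ) (eps p L V y s * ppi p L t)) univ).trans ?_
      apply prod_congr rfl
      intro η _
      rw [map_mul, SS_eps, SS_ppi, map_mul]
      rfl
    rw [e, norm_prod]
    calc _ ≤ ∏ η : H, (16 * (y : ℝ)) := by
          apply prod_le_prod
          · intro _ _; positivity
          · intro η _
            rw [norm_mul]
            have h1 := norm_eps p L V y hVy φ ((η : (ZMod p)ˣ) * s)
            have h2 := norm_ppi p L φ ((η : (ZMod p)ˣ) * t)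
            calc _ ≤ (4 * (y : ℝ)) * 4 :=
                  mul_le_mul h1 h2 (norm_nonneg _) ((norm_nonneg _).trans h1)
              _ = _ := by ring
      _ = _ := by rw [prod_const, card_univ]
  exact norm_final L κ Bd A _ hκ3 hκ1 hBd0 hAB _ (fun φ => hb φ a 1) (fun φ => hb φ 1 a)

end Cyc6

/-- Sum of `n` base-four digits of `A`, along an arithmetic progression modulo `p`. -/
def digSum (A p t : ℕ) (n : ℕ) : ℕ :=
  Nat.rec 0 (fun i ih => Nat.add ih (Nat.mod (Nat.div A (Nat.pow 4
    (Nat.mod (Nat.mul t (Nat.succ (Nat.mul 3 i))) p))) 4)) n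

/-- The check of the certificate. -/
def certCheck (p e c0 A k : ℕ) (n : ℕ) : Bool :=
  Nat.rec true (fun t ih =>
    bif Nat.beq (Nat.mod (digSum A p (Nat.succ t) k) 3)
      (Nat.mod (Nat.add c0 (bif Nat.beq (Nat.mod (Nat.pow (Nat.succ t) e) p) 1 then 1 else 0)) 3)
    then ih else false) n

lemma digSum_eq (A p t n : ℕ) :
    digSum A p t n = ∑ i ∈ Finset.range n, A / 4 ^ (t * (3 * i + 1) % p) % 4 := by
  induction n with
  | zero => rfl
  | succ n ih => rw [Finset.sum_range_succ, ← ih]; rfl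

lemma certCheck_spec (p e c0 A k n : ℕ) (h : certCheck p e c0 A k n = true) (t : ℕ) (ht : t < n) :
    digSum A p (t + 1) k % 3 = (c0 + if (t + 1) ^ e % p = 1 then 1 else 0) % 3 := by
  induction n with
  | zero => omega
  | succ n ih =>
    have h' : (bif Nat.beq (digSum A p (n + 1) k % 3)
      ((c0 + (bif Nat.beq ((n + 1) ^ e % p) 1 then 1 else 0)) % 3)
      then certCheck p e c0 A k n else false) = true := h
    rw [Bool.cond_false_right, Bool.and_eq_true] at h'
    obtain ⟨h1, h2⟩ := h'
    rcases Nat.lt_succ_iff_lt_or_eq.1 ht with h3 | rfl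
    · exact ih h2 h3
    · rw [Nat.eq_of_beq_eq_true h1]
      congr 2
      by_cases hc : (t + 1) ^ e % p = 1
      · rw [if_pos hc, hc]; rfl
      · rw [if_neg hc]
        have : Nat.beq ((t + 1) ^ e % p) 1 = false := by
          rw [Bool.eq_false_iff]; intro h; exact hc (Nat.eq_of_beq_eq_true h)
        rw [this]; rfl

section Final

open NumberField IsCyclotomicExtension Finset

variable (p : ℕ) [hpF : Fact p.Prime] (L : Type) [Field L] [NumberField L]
  [hcyc : IsCyclotomicExtension {p} ℚ L]

lemma exists_Lam (h3 : p % 3 = 2) (e c0 A : ℕ)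
    (hcert : certCheck p e c0 A ((p + 1) / 3) (p - 1) = true) :
    ∃ Λ : 𝓞 L →+ ZMod 3, ∀ b : (ZMod p)ˣ, Λ (ff p L b) =
      (c0 : ZMod 3) + open Classical in if b ∈ rootsOfUnity e (ZMod p) then 1 else 0 := by
  classical
  set h0 : ZMod p → ZMod 3 := fun x => ((A / 4 ^ x.val % 4 : ℕ) : ZMod 3) with hh0
  set h : ZMod p → ZMod 3 := Function.update h0 0 (-∑ y ∈ univ.erase (0 : ZMod p), h0 y) with hh
  have hsum : ∑ a, h a = 0 := by
    rw [← add_sum_erase univ h (mem_univ 0)]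
    have : ∑ x ∈ univ.erase (0 : ZMod p), h x = ∑ x ∈ univ.erase (0 : ZMod p), h0 x := by
      apply sum_congr rfl
      intro x hx
      rw [hh, Function.update_of_ne (ne_of_mem_erase hx)]
    rw [this, hh, Function.update_self, neg_add_cancel]
  obtain ⟨Λ, hΛ⟩ := exists_functional p L h hsum
  refine ⟨Λ, fun b => ?_⟩
  have hbpos : 0 < (b : ZMod p).val := Nat.pos_of_ne_zero (by
    rw [Ne, ZMod.val_eq_zero]; exact b.ne_zero)
  have hblt : (b : ZMod p).val < p := ZMod.val_lt _
  have hc := certCheck_spec p e c0 A _ _ hcert ((b : ZMod p).val - 1) (by omega)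
  rw [Nat.sub_add_cancel hbpos] at hc
  have hmem : (b : ZMod p).val ^ e % p = 1 ↔ b ∈ rootsOfUnity e (ZMod p) := by
    rw [mem_rootsOfUnity']
    have h1 : (b : ZMod p) ^ e = (((b : ZMod p).val ^ e : ℕ) : ZMod p) := by simp
    have h2 : (1 : ZMod p) = ((1 : ℕ) : ZMod p) := by simp
    rw [h1, h2, ZMod.natCast_eq_natCast_iff', Nat.mod_eq_of_lt hpF.out.one_lt]
  have hs : Λ (ff p L b) = ((digSum A p (b : ZMod p).val ((p + 1) / 3) : ℕ) : ZMod 3) := by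
    rw [digSum_eq, ff, map_sum, Nat.cast_sum]
    apply sum_congr rfl
    intro i hi
    rw [mem_range] at hi
    have hne : (b : ZMod p) * ((3 * i + 1 : ℕ) : ZMod p) ≠ 0 := by
      apply mul_ne_zero b.ne_zero
      rw [Ne, ZMod.natCast_eq_zero_iff]
      intro hdvd
      have := Nat.le_of_dvd (by omega) hdvd
      omega
    rw [hΛ, hh, Function.update_of_ne hne, hh0]
    have : ((b : ZMod p) * ((3 * i + 1 : ℕ) : ZMod p)).val = (b : ZMod p).val * (3 * i + 1) % p := by
      rw [ZMod.val_mul, ZMod.val_natCast, Nat.mul_mod_mod]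
    simp only [this]
  rw [hs]
  have hcast : ((digSum A p (b : ZMod p).val ((p + 1) / 3) : ℕ) : ZMod 3) =
      ((c0 + if (b : ZMod p).val ^ e % p = 1 then 1 else 0 : ℕ) : ZMod 3) := by
    rw [ZMod.natCast_eq_natCast_iff']; exact hc
  rw [hcast, Nat.cast_add]
  congr 1
  by_cases hb : b ∈ rootsOfUnity e (ZMod p)
  · rw [if_pos hb, if_pos (hmem.2 hb)]; simp
  · rw [if_neg hb, if_neg (fun h => hb (hmem.1 h))]; simp

end Final

lemma exp_bound (m : ℕ) (hm : 4 ≤ m) : 52 * (m + 8) ≤ 3 ^ (2 * m - 2) := by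
  obtain ⟨j, rfl⟩ : ∃ j, m = j + 4 := ⟨m - 4, by omega⟩
  have : 2 * (j + 4) - 2 = 2 * j + 6 := by omega
  rw [this]
  clear this hm
  induction j with
  | zero => norm_num
  | succ j ih =>
    have : 3 ^ (2 * (j + 1) + 6) = 9 * 3 ^ (2 * j + 6) := by ring
    omega

lemma final_case (p k e c0 A : ℕ) (hp : p.Prime) (hpk : p = 24 * k + 11)
    (hk : k % 5 = 2 ∨ k % 5 = 3 ∨ k % 5 = 4) (he0 : e ≠ 0) (he : e ≤ 26) (hep : e < p - 1)
    (hple : p ≤ 947)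
    (hcert : certCheck p e c0 A ((p + 1) / 3) (p - 1) = true) :
    ¬ ∃ x y m : ℕ, 0 < x ∧ 0 < y ∧ 0 < m ∧ Nat.gcd x y = 1 ∧ x ^ 2 + 3 ^ (2 * m) = 2 * y ^ p := by
  rintro ⟨x, y, m, hx, hy, hm, hxy, h⟩
  obtain ⟨w, hw0, hw3, hwy, him⟩ := reduction p k hpk x y m hx hy hm hxy h
  have hm4 : 4 ≤ m := by
    by_contra hlt
    have : m = 1 ∨ m = 2 ∨ m = 3 := by omega
    rw [hpk] at him
    rcases this with rfl | rfl | rfl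
    · have := small_one k w
      norm_num at him this
      tauto
    · have := small_two k w
      norm_num at him this
      tauto
    · have := small_three k hk w
      norm_num at him this
      tauto
  have hwlt : w < (p : ℤ) * 3 ^ m := by
    by_contra hge
    have hb := gi_bound k w (3 ^ m) (by positivity) (by
      have : ((24 * k + 11 : ℕ) : ℤ) = 24 * k + 11 := by push_cast; ring
      rw [← this, ← hpk]; omega)
    rw [← hpk] at hb
    have : (0 : ℤ) < 2 ^ (12 * k + 5) * 3 ^ m := by positivity
    rcases him with e | e <;> omega
  have hpF : Fact p.Prime := ⟨hp⟩
  have hpos : NeZero p := ⟨hp.ne_zero⟩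
  have heN : NeZero e := ⟨he0⟩
  have h3 : p % 3 = 2 := by omega
  have hcyc : @IsCyclotomicExtension {p} ℚ (CyclotomicField p ℚ) _ _ DivisionRing.toRatAlgebra := by
    have h1 : @IsCyclotomicExtension {p} ℚ (CyclotomicField p ℚ) _ _ (CyclotomicField.algebra p ℚ) :=
      inferInstance
    have h2 : CyclotomicField.algebra p ℚ = DivisionRing.toRatAlgebra := Subsingleton.elim _ _
    rw [← h2]; exact h1
  obtain ⟨Λ, hΛ⟩ := exists_Lam p (CyclotomicField p ℚ) h3 e c0 A hcert
  have hcardp : Nat.card (ZMod p)ˣ = p - 1 := by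
    rw [Nat.card_eq_fintype_card, ZMod.card_units_eq_totient, Nat.totient_prime hp]
  let _ : Fintype (rootsOfUnity e (ZMod p)) := Fintype.ofFinite _
  have hcardle : Fintype.card (rootsOfUnity e (ZMod p)) ≤ e := by
    rw [← Nat.card_eq_fintype_card]; exact card_rootsOfUnity (ZMod p) e
  have hH : ((Nat.card (rootsOfUnity e (ZMod p)) : ℕ) : ZMod 3) ≠ 0 := by
    rw [Ne, ZMod.natCast_eq_zero_iff]
    intro hd
    have := hd.trans (Subgroup.card_subgroup_dvd_card (rootsOfUnity e (ZMod p)))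
    rw [hcardp] at this
    omega
  obtain ⟨a, ha⟩ : ∃ a : (ZMod p)ˣ, a ∉ rootsOfUnity e (ZMod p) := by
    by_contra hcon
    push Not at hcon
    have htop : rootsOfUnity e (ZMod p) = ⊤ := by
      rw [Subgroup.eq_top_iff']; exact hcon
    have : Nat.card (rootsOfUnity e (ZMod p)) = p - 1 := by
      rw [htop, Subgroup.card_top, hcardp]
    rw [Nat.card_eq_fintype_card] at this
    omega
  have hmain := cyc_main p (CyclotomicField p ℚ) h3 (rootsOfUnity e (ZMod p)) Λ c0 hΛ hH
    (12 * k + 5) (by omega) a ha m hm w y hw3 hwy him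
  -- the size estimate
  set c := Fintype.card (rootsOfUnity e (ZMod p)) with hc
  have h16 : 16 * (y : ℤ) ≤ 9 ^ (m + 8) := by
    have e1 : (3 : ℤ) ^ m * 3 ^ m = 9 ^ m := by rw [← mul_pow]; norm_num
    have e2 : w ^ 2 ≤ (947 * 3 ^ m) ^ 2 := by
      apply pow_le_pow_left₀ hw0
      have : (p : ℤ) ≤ 947 := by exact_mod_cast hple
      have h3m : (0 : ℤ) < 3 ^ m := by positivity
      nlinarith
    have e3 : (9 : ℤ) ^ (m + 8) = 43046721 * 9 ^ m := by rw [pow_add]; ring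
    have e4 : (0 : ℤ) < 9 ^ m := by positivity
    rw [e3]
    nlinarith
  have h16R : 16 * (y : ℝ) ≤ 9 ^ (m + 8) := by exact_mod_cast h16
  have hy1 : (1 : ℝ) ≤ 16 * (y : ℝ) := by
    have : (1 : ℝ) ≤ y := by exact_mod_cast hy
    linarith
  obtain ⟨N, hN⟩ : ∃ N, N = 3 ^ (2 * m - 2) := ⟨_, rfl⟩
  have hM : 3 ^ (2 * m - 1) = 3 * N := by
    rw [hN, ← pow_succ']; congr 1; omega
  have hNb : 52 * (m + 8) ≤ N := hN ▸ exp_bound m hm4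
  have hbd : (16 * (y : ℝ)) ^ c ≤ 3 ^ N := by
    calc (16 * (y : ℝ)) ^ c ≤ (16 * (y : ℝ)) ^ 26 := pow_le_pow_right₀ hy1 (by omega)
      _ ≤ (9 ^ (m + 8)) ^ 26 := pow_le_pow_left₀ (by linarith) h16R _
      _ = (3 : ℝ) ^ (52 * (m + 8)) := by
          rw [← pow_mul, show (9 : ℝ) = 3 ^ 2 by norm_num, ← pow_mul]; congr 1; ring
      _ ≤ 3 ^ N := pow_le_pow_right₀ (by norm_num) hNb
  rw [hM, pow_mul, pow_mul] at hmain
  have hmain2 : ((3 : ℝ) ^ 3) ^ N ≤ (24 : ℝ) ^ N := by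
    calc _ ≤ ((2 : ℝ) ^ 3) ^ N * (16 * (y : ℝ)) ^ c := by exact_mod_cast hmain
      _ ≤ ((2 : ℝ) ^ 3) ^ N * 3 ^ N := by gcongr
      _ = 24 ^ N := by rw [← mul_pow]; norm_num
  have hlt : (24 : ℝ) ^ N < ((3 : ℝ) ^ 3) ^ N :=
    pow_lt_pow_left₀ (by norm_num) (by norm_num) (by omega)
  linarith

/-- The certificate for `59`. -/
lemma cert_59 : certCheck 59 2 0
    51973781258987544721107424662159520
    20 58 = true := by decide +kernel

/-- The certificate for `83`. -/
lemma cert_83 : certCheck 83 2 0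
    36723646277535826765996361805729698296559342848100
    28 82 = true := by decide +kernel

/-- The certificate for `107`. -/
lemma cert_107 : certCheck 107 2 1
    10298216276408716618298612218509872491535095059914628282127360100
    36 106 = true := by decide +kernel

/-- The certificate for `179`. -/
lemma cert_179 : certCheck 179 2 1
    354072581041381864703909670625345920348529544748513065509769372477391535430078566350414007069539825086965400
    60 178 = true := by decide +kernel

/-- The certificate for `227`. -/
lemma cert_227 : certCheck 227 2 0
    24264656651716575527136336854503793204013008821474191610812738763183229106736119269920046749975779533640958690221258520051415658958784840
    76 226 = true := by decide +kernel

/-- The certificate for `347`. -/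
lemma cert_347 : certCheck 347 2 0
    1979000054346813641124055848410290072683766727730046718002409752099010880745110955338999514701989291659298419554833679256418311958713986434343293224937081607459375405676048781303576082820229384645258040746560
    116 346 = true := by decide +kernel

/-- The certificate for `419`. -/
lemma cert_419 : certCheck 419 2 0
    978341888371538529703542683087905200760608884497786553972289044376773850249534712380708265520937609328725883671626235112798043874485734541741470791423963840359846535148924903565051353086904781212710022226986875569778036739539161333221576924199695509640
    140 418 = true := by decide +kernel

/-- The certificate for `443`. -/
lemma cert_443 : certCheck 443 26 0
    129490959826835701120048926778631495656097417179171692529889519674562075530762931104323361084937076062884349080870944687018419353893381854404635596311956020280048993162274201579123801564296701982732137160841097376690009697169938752715822117493765571216303645928784900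
    148 442 = true := by decide +kernel

/-- The certificate for `467`. -/
lemma cert_467 : certCheck 467 2 1
    38933344475350932249879493451525437093868503284759121532520567919465832264968501641860535179455373329582775621730308739994157759438125513281996845692271995462403137584177693559373374060827919966049091768014993898350752787477634308261044244939114064509816549203467611677442323392580
    156 466 = true := by decide +kernel

/-- The certificate for `563`. -/
lemma cert_563 : certCheck 563 2 0
    307479260558112017596999266034488435770571553547372633460408886233121663738392424346271739839095150195822828587479109253652557908692632262809441555774546060607599860043929522462725761195149144376962156801790983593330639389227749933757786990566926153018828626146618501181753606821904645925940763071765529238159342074813902464663818775205460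
    188 562 = true := by decide +kernel

/-- The certificate for `587`. -/
lemma cert_587 : certCheck 587 2 0
    165641962259840787003017856003800088381722733156153672341090782306907995392774632975878195668600869078476079580578993652034480617599919980434992778790897269028156463796211812777952844047433760350776468916484545407926752908880137081874829903353490082994322834819260666752383814143839039913324955220522638308971099669658308530308653568285920516575133517160
    196 586 = true := by decide +kernel

/-- The certificate for `659`. -/
lemma cert_659 : certCheck 659 2 0
    3041857134002031303401712119137260426786174709473832689225535418318623032969256088953975935430909033793850875087333790745226083438116602281075841801840653061947108620862723961389299065419001299733990752298639396471735544855532112619136520027604626639753738169202331675623322753394313292162792210774659109348917296855507005798357680674459789958314833357980698904707556359821566343886749470590275720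
    220 658 = true := by decide +kernel

/-- The certificate for `683`. -/
lemma cert_683 : certCheck 683 2 1
    610673653865504977818644331199831575528176305980661079995374401941284592891135838001090213138684796714146641644722646381383844291644976635737737261117363849768248648735185555544686352219254786476422589413940279195833875118289491221339557057245998088156305998664706266352096903485010951495356540340089488800455277892603857880760575257306040293049578348593024270230239218968159280040677760051299274321933324587300
    228 682 = true := by decide +kernel

/-- The certificate for `827`. -/
lemma cert_827 : certCheck 827 2 1
    16882431781084232322884529261704236359903293697880276230204768087418699952354318669770574081392742352543357414238748487639355648437033284686313151807831262797058236274881005507029074586327870791606140917915614093161470356748367557421669202241845744871157714768581431253326917268950853248297053572322069385797778697913807431776998525752624138622073648858765184159311985511596556881668024729078731444478955246885349537960390158392253564788220087440542998677207531667970892655026674763222178799641920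
    276 826 = true := by decide +kernel

/-- The certificate for `947`. -/
lemma cert_947 : certCheck 947 2 0
    92085506189909611269019338460375204017068139606887929329236131648893852071384643212634689242721032565213061259574341058705406717928389131681991185936586011680921815253338768768457502809785018094625521232358210128488612666978175727109494149434822355641389007025185883604756167224935497289517341726783594511431882223899435874665402206958398657440267027019916888238203002569889797932126429671218355714646471130312112154708519016581166307249275181740486613509771149793023662232282641161172400546616518528569488241946637444153242498868815196882991828486740208984211830646800
    316 946 = true := by decide +kernel

theorem no_solution_hanrot_primes (p : ℕ) (hp : Nat.Prime p)
    (hcase : p = 59 ∨ p = 83 ∨ p = 107 ∨ p = 179 ∨ p = 227 ∨ p = 347 ∨ p = 419 ∨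
      p = 443 ∨ p = 467 ∨ p = 563 ∨ p = 587 ∨ p = 659 ∨ p = 683 ∨ p = 827 ∨ p = 947) :
    ¬ ∃ x y m : ℕ, 0 < x ∧ 0 < y ∧ 0 < m ∧ Nat.gcd x y = 1 ∧
      x ^ 2 + 3 ^ (2 * m) = 2 * y ^ p := by
  rcases hcase with rfl | rfl | rfl | rfl | rfl | rfl | rfl | rfl | rfl | rfl | rfl | rfl | rfl | rfl | rfl
  · exact final_case 59 2 2 0 _ hp (by norm_num) (by norm_num) (by norm_num)
      (by norm_num) (by norm_num) (by norm_num) cert_59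
  · exact final_case 83 3 2 0 _ hp (by norm_num) (by norm_num) (by norm_num)
      (by norm_num) (by norm_num) (by norm_num) cert_83
  · exact final_case 107 4 2 1 _ hp (by norm_num) (by norm_num) (by norm_num)
      (by norm_num) (by norm_num) (by norm_num) cert_107
  · exact final_case 179 7 2 1 _ hp (by norm_num) (by norm_num) (by norm_num)
      (by norm_num) (by norm_num) (by norm_num) cert_179
  · exact final_case 227 9 2 0 _ hp (by norm_num) (by norm_num) (by norm_num)
      (by norm_num) (by norm_num) (by norm_num) cert_227
  · exact final_case 347 14 2 0 _ hp (by norm_num) (by norm_num) (by norm_num)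
      (by norm_num) (by norm_num) (by norm_num) cert_347
  · exact final_case 419 17 2 0 _ hp (by norm_num) (by norm_num) (by norm_num)
      (by norm_num) (by norm_num) (by norm_num) cert_419
  · exact final_case 443 18 26 0 _ hp (by norm_num) (by norm_num) (by norm_num)
      (by norm_num) (by norm_num) (by norm_num) cert_443
  · exact final_case 467 19 2 1 _ hp (by norm_num) (by norm_num) (by norm_num)
      (by norm_num) (by norm_num) (by norm_num) cert_467
  · exact final_case 563 23 2 0 _ hp (by norm_num) (by norm_num) (by norm_num)
      (by norm_num) (by norm_num) (by norm_num) cert_563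
  · exact final_case 587 24 2 0 _ hp (by norm_num) (by norm_num) (by norm_num)
      (by norm_num) (by norm_num) (by norm_num) cert_587
  · exact final_case 659 27 2 0 _ hp (by norm_num) (by norm_num) (by norm_num)
      (by norm_num) (by norm_num) (by norm_num) cert_659
  · exact final_case 683 28 2 1 _ hp (by norm_num) (by norm_num) (by norm_num)
      (by norm_num) (by norm_num) (by norm_num) cert_683
  · exact final_case 827 34 2 1 _ hp (by norm_num) (by norm_num) (by norm_num)
      (by norm_num) (by norm_num) (by norm_num) cert_827
  · exact final_case 947 39 2 0 _ hp (by norm_num) (by norm_num) (by norm_num)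
      (by norm_num) (by norm_num) (by norm_num) cert_947
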